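/- arXiv:2401.04581 — 8 statements merged into one kernel-verified Lean document; each statement's English description precedes it below -/
import Mathlib

section
/- The metaplectic representation is a homomorphism of Lie algebras: for any two matrices M, M' in the symplectic Lie algebra sp_{2n}(K), one has ρ([M, M']) = ρ(M) ∘ ρ(M') − ρ(M') ∘ ρ(M) as K-linear endomorphisms of the polynomial ring K[X₁,…,Xₙ]. -/
open MvPolynomial Matrix

/-- The metaplectic representation: for a matrix `M` written in block form
`[[A, B], [C, -Aᵀ]]` (blocks indexed by `Sum.inl`/`Sum.inr`), the operator
`f ↦ -(tr A / 2) f - ∑ A_{ij} X_j ∂_i f + (1/2) ∑ B_{ij} ∂_i ∂_j f - (1/2) ∑ C_{ij} X_i X_j f`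
on the polynomial ring `K[X₁, …, Xₙ]`. -/
noncomputable def metaRho {K : Type*} [Field K] {n : ℕ}
    (M : Matrix (Fin n ⊕ Fin n) (Fin n ⊕ Fin n) K) :
    MvPolynomial (Fin n) K → MvPolynomial (Fin n) K := fun f =>
  (-(∑ i : Fin n, M (Sum.inl i) (Sum.inl i)) / 2) • f
    - ∑ i : Fin n, ∑ j : Fin n, M (Sum.inl i) (Sum.inl j) • (X j * pderiv i f)
    + (1 / 2 : K) • ∑ i : Fin n, ∑ j : Fin n, M (Sum.inl i) (Sum.inr j) • pderiv i (pderiv j f)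
    - (1 / 2 : K) • ∑ i : Fin n, ∑ j : Fin n, M (Sum.inr i) (Sum.inl j) • (X i * X j * f)

section WeylQuadratic

variable {K R ι : Type*} [Field K] [Ring R] [Algebra K R] [Fintype ι]

/-- The quadratic element `(1/2) ∑ S_{ab} u_a u_b` of an algebra. -/
noncomputable def weylQuadratic (u : ι → R) (S : Matrix ι ι K) : R :=
  (1 / 2 : K) • ∑ a, ∑ b, S a b • (u a * u b)

theorem weylQuadratic_sub (u : ι → R) (S T : Matrix ι ι K) :
    weylQuadratic u (S - T) = weylQuadratic u S - weylQuadratic u T := by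
  simp [weylQuadratic, sub_smul, Finset.sum_sub_distrib, smul_sub]

/-- If the commutators of the `u_a` are the scalars `ω_{ab}`, then bracketing with a symmetric
quadratic element acts linearly on the `u_a`, through the matrix `S ω`. -/
theorem weylQuadratic_commutator_generator [CharZero K] {u : ι → R} {ω S : Matrix ι ι K}
    (hu : ∀ a b, u a * u b - u b * u a = algebraMap K R (ω a b)) (hS : S.IsSymm) (c : ι) :
    weylQuadratic u S * u c - u c * weylQuadratic u S = ∑ a, (S * ω) a c • u a := by
  have key (a b : ι) : S a b • (u a * u b) * u c - u c * (S a b • (u a * u b))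
      = (S a b * ω b c) • u a + (S b a * ω a c) • u b := by
    have h : u a * u b * u c - u c * (u a * u b)
        = u a * (u b * u c - u c * u b) + (u a * u c - u c * u a) * u b := by noncomm_ring
    rw [smul_mul_assoc, mul_smul_comm, ← smul_sub, h, hu, hu, hS.apply a b, ← Algebra.commutes,
      ← Algebra.smul_def, ← Algebra.smul_def, smul_add, smul_smul, smul_smul]
  have hsum : ∑ a, ∑ b, (S a b * ω b c) • u a = ∑ a, (S * ω) a c • u a := by
    simp [Matrix.mul_apply, Finset.sum_smul]
  rw [weylQuadratic, smul_mul_assoc, mul_smul_comm, ← smul_sub, Finset.sum_mul, Finset.mul_sum,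
    ← Finset.sum_sub_distrib]
  simp_rw [Finset.sum_mul, Finset.mul_sum, ← Finset.sum_sub_distrib, key, Finset.sum_add_distrib]
  rw [Finset.sum_comm (f := fun a b => (S b a * ω a c) • u b), hsum, ← two_smul K, smul_smul]
  norm_num

/-- The commutator of two symmetric quadratic elements is the quadratic element of
`S ω T - T ω S`. -/
theorem weylQuadratic_commutator [CharZero K] {u : ι → R} {ω S T : Matrix ι ι K}
    (hu : ∀ a b, u a * u b - u b * u a = algebraMap K R (ω a b)) (hω : ωᵀ = -ω)
    (hS : S.IsSymm) :
    weylQuadratic u S * weylQuadratic u T - weylQuadratic u T * weylQuadratic u S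
      = weylQuadratic u (S * ω * T - T * ω * S) := by
  have key (c d : ι) :
      weylQuadratic u S * (T c d • (u c * u d)) - T c d • (u c * u d) * weylQuadratic u S
        = ∑ a, ((S * ω) a c * T c d) • (u a * u d)
          + ∑ a, (T c d * (S * ω) a d) • (u c * u a) := by
    have h (q : R) : q * (u c * u d) - u c * u d * q
        = (q * u c - u c * q) * u d + u c * (q * u d - u d * q) := by noncomm_ring
    rw [smul_mul_assoc, mul_smul_comm, ← smul_sub, h,
      weylQuadratic_commutator_generator hu hS, weylQuadratic_commutator_generator hu hS]
    simp only [Finset.sum_mul, Finset.mul_sum, smul_add, Finset.smul_sum, smul_mul_assoc,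
      mul_smul_comm, smul_smul, mul_comm (T c d)]
  have hleft : ∑ c, ∑ d, ∑ a, ((S * ω) a c * T c d) • (u a * u d)
      = ∑ a, ∑ d, (S * ω * T) a d • (u a * u d) := by
    simp_rw [Matrix.mul_apply (M := S * ω), Finset.sum_smul]
    rw [Finset.sum_comm_cycle]
    exact Finset.sum_congr rfl fun _ _ => Finset.sum_comm
  have hright : ∑ c, ∑ d, ∑ a, (T c d * (S * ω) a d) • (u c * u a)
      = -∑ c, ∑ a, (T * ω * S) c a • (u c * u a) := by
    have hneg : T * ω * S = -(T * (S * ω)ᵀ) := by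
      rw [Matrix.transpose_mul, hω, hS.eq]
      simp [Matrix.mul_assoc]
    rw [hneg]
    simp_rw [Matrix.neg_apply, neg_smul, Finset.sum_neg_distrib, neg_neg, Matrix.mul_apply (M := T),
      Matrix.transpose_apply, Finset.sum_smul]
    exact Finset.sum_congr rfl fun _ _ => Finset.sum_comm
  rw [weylQuadratic_sub]
  conv_lhs => rw [weylQuadratic.eq_def u T]
  rw [smul_mul_assoc, mul_smul_comm, ← smul_sub, Finset.sum_mul, Finset.mul_sum,
    ← Finset.sum_sub_distrib]
  simp_rw [Finset.sum_mul, Finset.mul_sum, ← Finset.sum_sub_distrib, key, Finset.sum_add_distrib]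
  rw [hleft, hright, ← sub_eq_add_neg, smul_sub, weylQuadratic, weylQuadratic]

end WeylQuadratic

section Metaplectic

variable {K : Type*} [Field K] {n : ℕ}

/-- The generators of the Weyl algebra acting on polynomials: `∂_i` at `Sum.inl i` and
multiplication by `X_i` at `Sum.inr i`. -/
noncomputable def weylGenerator (K : Type*) [Field K] (n : ℕ) :
    Fin n ⊕ Fin n → Module.End K (MvPolynomial (Fin n) K) :=
  Sum.elim (fun i => (pderiv i).toLinearMap) (fun i => LinearMap.mulLeft K (X i))

@[simp]
theorem weylGenerator_inl_apply (i : Fin n) (f : MvPolynomial (Fin n) K) :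
    weylGenerator K n (Sum.inl i) f = pderiv i f := rfl

@[simp]
theorem weylGenerator_inr_apply (i : Fin n) (f : MvPolynomial (Fin n) K) :
    weylGenerator K n (Sum.inr i) f = X i * f := rfl

theorem pderiv_X_mul (i j : Fin n) (f : MvPolynomial (Fin n) K) :
    pderiv i (X j * f) = X j * pderiv i f + (1 : Matrix (Fin n) (Fin n) K) i j • f := by
  rw [Derivation.leibniz, pderiv_X, Matrix.one_apply]
  rcases eq_or_ne i j with rfl | h
  · simp
  · simp [h]

theorem pderiv_pderiv_comm (i j : Fin n) (f : MvPolynomial (Fin n) K) :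
    pderiv i (pderiv j f) = pderiv j (pderiv i f) := by
  have h : ⁅pderiv (R := K) i, pderiv (R := K) j⁆ = 0 := by
    refine MvPolynomial.derivation_ext fun k => ?_
    rw [Derivation.commutator_apply, pderiv_X, pderiv_X]
    simp [Pi.single_apply, apply_ite]
  simpa [Derivation.commutator_apply, sub_eq_zero] using DFunLike.congr_fun h f

theorem weylGenerator_commutator (a b : Fin n ⊕ Fin n) :
    weylGenerator K n a * weylGenerator K n b - weylGenerator K n b * weylGenerator K n a
      = algebraMap K _ ((-Matrix.J (Fin n) K) a b) := by
  refine LinearMap.ext fun f => ?_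
  rw [Module.algebraMap_end_apply]
  rcases a with i | i <;> rcases b with j | j <;>
    simp only [Matrix.J, LinearMap.sub_apply, Module.End.mul_apply, weylGenerator_inl_apply,
      weylGenerator_inr_apply, pderiv_X_mul, Matrix.neg_apply, Matrix.fromBlocks_apply₁₁,
      Matrix.fromBlocks_apply₁₂, Matrix.fromBlocks_apply₂₁, Matrix.fromBlocks_apply₂₂]
  · simp [pderiv_pderiv_comm i j f]
  · simp
  · simp [Matrix.one_apply, eq_comm]
  · simp [mul_left_comm (X i)]

theorem fromBlocks_eq_neg_J :
    Matrix.fromBlocks 0 1 (-1) 0 = -Matrix.J (Fin n) K := by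
  simp [Matrix.J, Matrix.fromBlocks_neg]

/-- The symplectic Lie algebra condition on `M` amounts to the symmetry of `M J`. -/
theorem isSymm_mul_J {M : Matrix (Fin n ⊕ Fin n) (Fin n ⊕ Fin n) K}
    (hM : Mᵀ * Matrix.fromBlocks 0 1 (-1) 0 + Matrix.fromBlocks 0 1 (-1) 0 * M = 0) :
    (M * Matrix.J (Fin n) K).IsSymm := by
  have h : Mᵀ * Matrix.J (Fin n) K = -(Matrix.J (Fin n) K * M) := by
    rw [fromBlocks_eq_neg_J, Matrix.mul_neg, Matrix.neg_mul, ← neg_add, neg_eq_zero] at hM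
    exact eq_neg_of_add_eq_zero_left hM
  have hJ := Matrix.J_squared (Fin n) K
  calc (M * Matrix.J (Fin n) K)ᵀ
      = Matrix.J (Fin n) K * (Mᵀ * Matrix.J (Fin n) K) * Matrix.J (Fin n) K := by
        rw [Matrix.transpose_mul, Matrix.J_transpose, Matrix.mul_assoc, Matrix.mul_assoc Mᵀ, hJ]
        simp
    _ = M * Matrix.J (Fin n) K := by
        rw [h, Matrix.mul_neg, ← Matrix.mul_assoc, hJ]
        simp

/-- The operator `metaRho M` is the Weyl-ordered quadratic operator with matrix `M J`. -/
theorem metaRho_eq_weylQuadratic [CharZero K] {M : Matrix (Fin n ⊕ Fin n) (Fin n ⊕ Fin n) K}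
    (hM : (M * Matrix.J (Fin n) K).IsSymm) (f : MvPolynomial (Fin n) K) :
    metaRho M f = weylQuadratic (weylGenerator K n) (M * Matrix.J (Fin n) K) f := by
  have hll (i j : Fin n) :
      (M * Matrix.J (Fin n) K) (Sum.inl i) (Sum.inl j) = M (Sum.inl i) (Sum.inr j) := by
    simp [Matrix.mul_apply, Matrix.J, Matrix.one_apply]
  have hlr (i j : Fin n) :
      (M * Matrix.J (Fin n) K) (Sum.inl i) (Sum.inr j) = -M (Sum.inl i) (Sum.inl j) := by
    simp [Matrix.mul_apply, Matrix.J, Matrix.one_apply]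
  have hrl (i j : Fin n) :
      (M * Matrix.J (Fin n) K) (Sum.inr i) (Sum.inl j) = -M (Sum.inl j) (Sum.inl i) := by
    rw [← hlr, hM.apply]
  have hrr (i j : Fin n) :
      (M * Matrix.J (Fin n) K) (Sum.inr i) (Sum.inr j) = -M (Sum.inr i) (Sum.inl j) := by
    simp [Matrix.mul_apply, Matrix.J, Matrix.one_apply]
  have htrace : ∑ i, ∑ j, M (Sum.inl i) (Sum.inl j) • (1 : Matrix (Fin n) (Fin n) K) i j • f
      = (∑ i, M (Sum.inl i) (Sum.inl i)) • f := by
    simp [Matrix.one_apply, Finset.sum_smul]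
  simp only [metaRho, weylQuadratic, Fintype.sum_sum_type, hll, hlr, hrl, hrr,
    LinearMap.smul_apply, LinearMap.add_apply, LinearMap.neg_apply, LinearMap.sum_apply,
    Module.End.mul_apply, weylGenerator_inl_apply, weylGenerator_inr_apply, pderiv_X_mul,
    neg_smul, smul_add, Finset.sum_neg_distrib, Finset.sum_add_distrib, htrace, mul_assoc]
  rw [Finset.sum_comm (f := fun i j => M (Sum.inl j) (Sum.inl i) • (X i * pderiv j f))]
  module

end Metaplectic

/-- The metaplectic representation is a Lie algebra homomorphism on `sp_{2n}(K)`: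
`ρ([M, M']) = ρ(M) ∘ ρ(M') - ρ(M') ∘ ρ(M)`. -/
theorem metaRho_lie_hom {K : Type*} [Field K] [CharZero K] {n : ℕ} (hn : 1 ≤ n)
    (M M' : Matrix (Fin n ⊕ Fin n) (Fin n ⊕ Fin n) K)
    (hM : Mᵀ * Matrix.fromBlocks 0 1 (-1) 0 + Matrix.fromBlocks 0 1 (-1) 0 * M = 0)
    (hM' : M'ᵀ * Matrix.fromBlocks 0 1 (-1) 0 + Matrix.fromBlocks 0 1 (-1) 0 * M' = 0)
    (f : MvPolynomial (Fin n) K) :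
    metaRho (M * M' - M' * M) f = metaRho M (metaRho M' f) - metaRho M' (metaRho M f) := by
  have hS := isSymm_mul_J hM
  have hS' := isSymm_mul_J hM'
  have hbracket : (M * M' - M' * M) * Matrix.J (Fin n) K
      = M * Matrix.J (Fin n) K * -Matrix.J (Fin n) K * (M' * Matrix.J (Fin n) K)
        - M' * Matrix.J (Fin n) K * -Matrix.J (Fin n) K * (M * Matrix.J (Fin n) K) := by
    simp only [Matrix.mul_neg, Matrix.mul_assoc M (Matrix.J _ _),
      Matrix.mul_assoc M' (Matrix.J _ _), Matrix.J_squared, Matrix.mul_one, neg_neg, Matrix.sub_mul, Matrix.mul_assoc]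
  have hω : (-Matrix.J (Fin n) K)ᵀ = -(-Matrix.J (Fin n) K) := by
    rw [Matrix.transpose_neg, Matrix.J_transpose]
  have hsymm : ((M * M' - M' * M) * Matrix.J (Fin n) K).IsSymm := by
    rw [hbracket, Matrix.IsSymm, Matrix.transpose_sub]
    simp only [Matrix.transpose_mul (_ * -Matrix.J (Fin n) K),
      Matrix.transpose_mul _ (-Matrix.J (Fin n) K), hω, hS.eq, hS'.eq]
    simp only [Matrix.mul_neg, Matrix.neg_mul, neg_neg, Matrix.mul_assoc]
    abel
  simp_rw [metaRho_eq_weylQuadratic hsymm, metaRho_eq_weylQuadratic hS,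
    metaRho_eq_weylQuadratic hS']
  rw [hbracket, ← weylQuadratic_commutator weylGenerator_commutator hω hS]
  rfl
end

section
/- The metaplectic representation is injective on the symplectic Lie algebra: if M ∈ sp_{2n}(K) satisfies ρ(M) = 0 as an endomorphism of K[X₁,…,Xₙ], then M = 0. -/
open MvPolynomial Matrix

/-- The second partial derivatives of the quadratic form attached to a matrix. -/
theorem pderiv_pderiv_quadratic {R σ : Type*} [CommRing R] [Fintype σ]
    (C : σ → σ → R) (a b : σ) :
    pderiv a (pderiv b (∑ i, ∑ j, C i j • (X i * X j : MvPolynomial σ R))) =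
      MvPolynomial.C (C a b + C b a) := by
  classical
  simp only [map_sum, Derivation.map_smul, Derivation.leibniz, pderiv_X, map_add, smul_eq_mul,
    Pi.single_apply, mul_ite, mul_one, mul_zero, smul_add,
    smul_ite, smul_zero, Finset.sum_add_distrib, Finset.sum_ite_eq',
    Finset.sum_ite_irrel, Finset.sum_const_zero, Finset.mem_univ, if_true]
  simp [smul_eq_C_mul]

/-- Contracting a matrix with the second partial derivatives of `X k * X l`. -/
theorem sum_smul_pderiv_pderiv_X_mul_X {R σ : Type*} [CommRing R] [Fintype σ]
    (B : σ → σ → R) (k l : σ) :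
    ∑ i, ∑ j, B i j • pderiv i (pderiv j (X k * X l : MvPolynomial σ R)) =
      MvPolynomial.C (B k l + B l k) := by
  classical
  simp only [Derivation.leibniz, pderiv_X, map_add, smul_eq_mul,
    Pi.single_apply, mul_ite, mul_one, mul_zero, apply_ite (pderiv _), map_zero, smul_add,
    smul_ite, smul_zero, Finset.sum_add_distrib, Finset.sum_ite_eq,
    Finset.mem_univ, if_true]
  simp [smul_eq_C_mul]

/-- The block form of the condition defining the symplectic Lie algebra. -/
theorem symplectic_blocks {R m : Type*} [CommRing R] [Fintype m] [DecidableEq m]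
    {M : Matrix (m ⊕ m) (m ⊕ m) R}
    (hM : Mᵀ * Matrix.fromBlocks 0 1 (-1) 0 + Matrix.fromBlocks 0 1 (-1) 0 * M = 0) :
    M.toBlocks₁₂ᵀ = M.toBlocks₁₂ ∧ M.toBlocks₂₁ᵀ = M.toBlocks₂₁ ∧
      M.toBlocks₂₂ = -M.toBlocks₁₁ᵀ := by
  rw [← Matrix.fromBlocks_toBlocks M, Matrix.fromBlocks_transpose, Matrix.fromBlocks_multiply,
    Matrix.fromBlocks_multiply, Matrix.fromBlocks_add, ← Matrix.fromBlocks_zero,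
    Matrix.fromBlocks_inj] at hM
  simp only [mul_zero, zero_mul, mul_one,
    one_mul, mul_neg, neg_mul, add_zero, zero_add] at hM
  obtain ⟨h11, h12, -, h22⟩ := hM
  refine ⟨?_, ?_, ?_⟩
  · exact add_neg_eq_zero.mp h22
  · exact neg_add_eq_zero.mp h11
  · exact eq_neg_of_add_eq_zero_right h12

/-- The metaplectic representation is injective on `sp_{2n}(K)`: if `M ∈ sp_{2n}(K)`
acts as zero on `K[X₁, …, Xₙ]`, then `M = 0`. -/
theorem metaRho_injective {K : Type*} [Field K] [CharZero K] {n : ℕ} (hn : 1 ≤ n)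
    (M : Matrix (Fin n ⊕ Fin n) (Fin n ⊕ Fin n) K)
    (hM : Mᵀ * Matrix.fromBlocks 0 1 (-1) 0 + Matrix.fromBlocks 0 1 (-1) 0 * M = 0)
    (h : ∀ f : MvPolynomial (Fin n) K, metaRho M f = 0) :
    M = 0 := by
  obtain ⟨hB, hC, hD⟩ := symplectic_blocks hM
  have eq_zero_of_self_add {x y : K} (hxy : y = x) (hx : x + y = 0) : x = 0 := by
    rw [hxy] at hx
    exact self_eq_neg.mp (eq_neg_of_add_eq_zero_left hx)
  have hC0 (a b) : M (Sum.inr a) (Sum.inl b) = 0 := by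
    have h1 := congrArg (fun p => pderiv a (pderiv b p)) (h 1)
    simp only [metaRho, pderiv_one, mul_zero, smul_zero, Finset.sum_const_zero, map_zero,
      mul_one, sub_zero, add_zero, map_sub, map_neg, Derivation.map_smul, zero_sub, neg_eq_zero,
      pderiv_pderiv_quadratic (fun i j => M (Sum.inr i) (Sum.inl j))] at h1
    rw [smul_eq_zero_iff_right (by norm_num), C_eq_zero] at h1
    exact eq_zero_of_self_add (congrFun₂ hC a b) h1
  have htr : -(∑ i : Fin n, M (Sum.inl i) (Sum.inl i)) / 2 = 0 := by
    simpa [metaRho, hC0, smul_eq_C_mul] using h 1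
  have hA0 (k l) : M (Sum.inl k) (Sum.inl l) = 0 := by
    have hk := congrArg (coeff (Finsupp.single l 1)) (h (X k))
    simpa [metaRho, hC0, htr, pderiv_X, Pi.single_apply, coeff_sum, coeff_X, apply_ite,
      Finsupp.single_left_inj] using hk
  have hB0 (k l) : M (Sum.inl k) (Sum.inr l) = 0 := by
    have hkl := h (X k * X l)
    simp only [metaRho, hA0, hC0, zero_smul, Finset.sum_const_zero, smul_zero, sub_zero,
      neg_zero, zero_div, zero_add, sum_smul_pderiv_pderiv_X_mul_X (fun i j => M (Sum.inl i) (Sum.inr j))] at hkl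
    rw [smul_eq_zero_iff_right (by norm_num), C_eq_zero] at hkl
    exact eq_zero_of_self_add (congrFun₂ hB k l) hkl
  ext (i | i) (j | j)
  · exact hA0 i j
  · exact hB0 i j
  · exact hC0 i j
  · simpa [Matrix.toBlocks₂₂, Matrix.toBlocks₁₁, hA0] using congrFun₂ hD i j
end

section
/- The completed Weyl algebra acts faithfully on polynomials, in the following formal sense: let c : ℕⁿ × ℕⁿ → K be any function (thought of as the coefficients of the formal operator ∑_{α,β} c(α,β) xᵅ∂ᵝ). Suppose that for every γ ∈ ℕⁿ and every δ ∈ ℕⁿ, the finite sum ∑_β c(δ − γ + β, β) · ∏_{i=1}^n γ_i!/(γ_i − β_i)! — taken over all β ∈ ℕⁿ with β_i ≤ γ_i and δ_i − γ_i + β_i ≥ 0 for all i (this sum is the coefficient of X^δ in the formal application of the operator to the monomial X^γ) — equals zero. Then c is identically zero. -/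
/-- The completed Weyl algebra acts faithfully on polynomials: if the coefficients
`c : ℕⁿ × ℕⁿ → K` of a formal operator `∑ c(α,β) xᵅ∂ᵝ` are such that, for every monomial
`X^γ` and every exponent `δ`, the coefficient of `X^δ` in the formal application of the
operator to `X^γ` vanishes, then `c = 0`.  The coefficient in question is the finite sum
`∑_{β ≤ γ, δ - γ + β ≥ 0} c(δ - γ + β, β) ∏ᵢ γᵢ!/(γᵢ - βᵢ)!`. -/
theorem weyl_faithful_on_polynomials {K : Type*} [Field K] [CharZero K] {n : ℕ} (hn : 1 ≤ n)
    (c : (Fin n → ℕ) × (Fin n → ℕ) → K)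
    (h : ∀ γ δ : Fin n → ℕ,
      ∑ β ∈ Finset.Iic γ,
        (if ∀ i, γ i ≤ δ i + β i
          then c (fun i => δ i + β i - γ i, β) * ∏ i, ((γ i).descFactorial (β i) : K)
          else 0) = 0) :
    c = 0 := by
  suffices H : ∀ β α : Fin n → ℕ, c (α, β) = 0 from funext fun ⟨α, β⟩ => H β α
  intro β
  induction β using WellFoundedLT.induction with
  | ind γ ih =>
    intro α
    have hγ := h γ α
    rw [Finset.sum_eq_single γ] at hγ
    · have hprod : ∏ i, ((γ i).descFactorial (γ i) : K) ≠ 0 :=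
        Finset.prod_ne_zero_iff.mpr fun i _ => by
          rw [Nat.descFactorial_self]
          exact_mod_cast Nat.factorial_ne_zero (γ i)
      simpa only [le_add_iff_nonneg_left, zero_le, implies_true, if_true, Nat.add_sub_cancel,
        mul_eq_zero, hprod, or_false] using hγ
    · intro β hβ hne
      rw [ih β (lt_of_le_of_ne (Finset.mem_Iic.mp hβ) hne), zero_mul, ite_self]
    · exact fun hmem => absurd (Finset.mem_Iic.mpr le_rfl) hmem
end

section
/- The family of K-linear endomorphisms of the polynomial ring K[X₁,…,Xₙ] given by f ↦ X₁^{α₁}⋯Xₙ^{αₙ}·(∂₁^{β₁}⋯∂ₙ^{βₙ} f), indexed by pairs (α, β) ∈ ℕⁿ × ℕⁿ, is linearly independent over K. -/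
open MvPolynomial

/-- The endomorphism `f ↦ X₁^{α₁}⋯Xₙ^{αₙ} · (∂₁^{β₁}⋯∂ₙ^{βₙ} f)` of `K[X₁, …, Xₙ]`. -/
noncomputable def xMulPderivPow {K : Type*} [CommRing K] {n : ℕ} (α β : Fin n → ℕ) :
    Module.End K (MvPolynomial (Fin n) K) :=
  LinearMap.mulLeft K (∏ i, X i ^ α i) *
    (((List.finRange n).map
      (fun i => ((pderiv i).toLinearMap : Module.End K (MvPolynomial (Fin n) K)) ^ β i)).prod)

/-- Iterating `∂ᵢ` on a monomial produces a descending factorial. -/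
theorem pderiv_pow_monomial {σ R : Type*} [CommSemiring R] (i : σ) (k : ℕ) (m : σ →₀ ℕ) (a : R) :
    (((pderiv i).toLinearMap : Module.End R (MvPolynomial σ R)) ^ k) (monomial m a) =
      monomial (m - Finsupp.single i k) (a * ((m i).descFactorial k : R)) := by
  induction k with
  | zero => simp
  | succ k ih =>
    rw [pow_succ', Module.End.mul_apply, ih, Derivation.coeFn_coe, pderiv_monomial, tsub_tsub, ← Finsupp.single_add]
    congr 1
    rw [Nat.descFactorial_succ]
    simp only [Finsupp.coe_tsub, Pi.sub_apply, Finsupp.single_eq_same, Nat.cast_mul]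
    ring

/-- The action of `∏ᵢ ∂ᵢ^{βᵢ}`, over a list of distinct variables, on a monomial. -/
theorem prod_map_pderiv_pow_monomial {σ R : Type*} [CommSemiring R] (β : σ → ℕ) (m : σ →₀ ℕ)
    (a : R) {l : List σ} (hl : l.Nodup) :
    ((l.map (fun i =>
        ((pderiv i).toLinearMap : Module.End R (MvPolynomial σ R)) ^ β i)).prod) (monomial m a) =
      monomial (m - (l.map fun i => Finsupp.single i (β i)).sum)
        (a * (l.map fun i => ((m i).descFactorial (β i) : R)).prod) := by
  induction l with
  | nil => simp
  | cons i l ih =>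
    obtain ⟨hi, hnd⟩ := List.nodup_cons.1 hl
    have hsum : (l.map fun j => Finsupp.single j (β j)).sum i = 0 := by
      clear ih hl hnd
      induction l with
      | nil => simp
      | cons j l ihl =>
        simp only [List.mem_cons, not_or] at hi
        simp [ihl hi.2, Finsupp.single_eq_of_ne hi.1]
    rw [List.map_cons, List.prod_cons, Module.End.mul_apply, ih hnd, pderiv_pow_monomial, tsub_tsub]
    simp only [List.map_cons, List.sum_cons, List.prod_cons, Finsupp.coe_tsub, Pi.sub_apply, hsum,
      tsub_zero]
    rw [add_comm]
    congr 1
    ring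

/-- The action of `x^α ∂^β` on a monomial. -/
theorem xMulPderivPow_monomial {K : Type*} [CommRing K] {n : ℕ} (α β : Fin n → ℕ)
    (m : Fin n →₀ ℕ) :
    xMulPderivPow (K := K) α β (monomial m 1) =
      monomial (Finsupp.equivFunOnFinite.symm α + (m - Finsupp.equivFunOnFinite.symm β))
        (∏ i, ((m i).descFactorial (β i) : K)) := by
  have hβ : ((List.finRange n).map fun i => Finsupp.single i (β i)).sum =
      Finsupp.equivFunOnFinite.symm β := by
    rw [← List.ofFn_eq_map, List.sum_ofFn]
    exact (Finsupp.equivFunOnFinite_symm_eq_sum β).symm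
  have hα : (∏ i, X i ^ α i : MvPolynomial (Fin n) K) =
      monomial (Finsupp.equivFunOnFinite.symm α) 1 := by
    rw [monomial_eq, Finsupp.prod_fintype _ _ (by simp)]
    simp
  rw [xMulPderivPow, Module.End.mul_apply,
    prod_map_pderiv_pow_monomial β m 1 (List.nodup_finRange n), hβ, ← List.ofFn_eq_map,
    List.prod_ofFn, LinearMap.mulLeft_apply, hα, monomial_mul, one_mul, one_mul]

/-- `x^α ∂^β` kills `x^m` unless `β ≤ m`. -/
theorem xMulPderivPow_monomial_eq_zero {K : Type*} [CommRing K] {n : ℕ} (α : Fin n → ℕ)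
    {β : Fin n → ℕ} {m : Fin n →₀ ℕ} (h : ¬ β ≤ m) :
    xMulPderivPow (K := K) α β (monomial m 1) = 0 := by
  obtain ⟨i, hi⟩ := not_forall.1 h
  rw [xMulPderivPow_monomial, Finset.prod_eq_zero (Finset.mem_univ i), monomial_zero]
  rw [Nat.descFactorial_of_lt (not_le.1 hi), Nat.cast_zero]

/-- The family of operators `x^α ∂^β` on `K[X₁, …, Xₙ]` is linearly independent over `K`. -/
theorem xMulPderivPow_linearIndependent {K : Type*} [Field K] [CharZero K] {n : ℕ}
    (hn : 1 ≤ n) :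
    LinearIndependent K
      (fun q : (Fin n → ℕ) × (Fin n → ℕ) => xMulPderivPow (K := K) (n := n) q.1 q.2) := by
  rw [linearIndependent_iff]
  intro c hc
  suffices h : ∀ β α, c (α, β) = 0 from Finsupp.ext fun q => h q.2 q.1
  intro β
  induction β using WellFoundedLT.induction with
  | ind β ih =>
    intro α
    have h := congrArg (fun T : Module.End K (MvPolynomial (Fin n) K) =>
      coeff (Finsupp.equivFunOnFinite.symm α)
        (T (monomial (Finsupp.equivFunOnFinite.symm β) 1))) hc
    simp only [Finsupp.linearCombination_apply, Finsupp.sum, LinearMap.sum_apply, coeff_sum,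
      LinearMap.smul_apply, coeff_smul, LinearMap.zero_apply, coeff_zero] at h
    rw [Finset.sum_eq_single (α, β)] at h
    · rw [xMulPderivPow_monomial, tsub_self, add_zero, coeff_monomial, if_pos rfl, smul_eq_mul] at h
      refine (mul_eq_zero.1 h).resolve_right (Finset.prod_ne_zero_iff.2 fun i _ => ?_)
      simp [Nat.descFactorial_self, Nat.factorial_ne_zero]
    · rintro ⟨α', β'⟩ - hne
      by_cases hle : β' ≤ β
      · rcases hle.eq_or_lt with rfl | hlt
        · rw [xMulPderivPow_monomial, tsub_self, add_zero, coeff_monomial, if_neg, smul_zero]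
          intro heq
          exact hne (Prod.ext (Finsupp.equivFunOnFinite.symm.injective heq) rfl)
        · rw [ih β' hlt, zero_smul]
      · rw [xMulPderivPow_monomial_eq_zero α' (by simpa using hle), coeff_zero, smul_zero]
    · intro hmem
      rw [Finsupp.notMem_support_iff.1 hmem, zero_smul]
end

section
/- The affinoid enveloping algebra of the Cartan subalgebra acts faithfully on polynomials, in the following sense: let λ : ℕⁿ → K be a family with λ_α → 0 as |α| → ∞ (i.e., for every ε > 0 only finitely many α have ‖λ_α‖ ≥ ε). Suppose that for every β ∈ ℕⁿ the convergent sum ∑'_{α ∈ ℕⁿ} λ_α · ∏_{i=1}^n (−1/2 − β_i)^{α_i} equals 0 in K. Then λ is identically zero. -/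
open Filter Topology

/-- A power series over a complete ultrametric field whose coefficients tend to `0` and which
vanishes along a sequence of nonzero points tending to `0` is zero. -/
theorem coeff_eq_zero_of_tsum_eq_zero {K : Type*} [NontriviallyNormedField K] [CompleteSpace K]
    [IsUltrametricDist K] {a : ℕ → K} (ha : Tendsto a atTop (𝓝 0)) {x : ℕ → K}
    (hx0 : ∀ m, x m ≠ 0) (hx : Tendsto x atTop (𝓝 0))
    (h : ∀ m, ∑' k, a k * x m ^ k = 0) : a = 0 := by
  let q : FormalMultilinearSeries K K K := FormalMultilinearSeries.ofScalars K a
  have hq : HasFPowerSeriesAt (fun z ↦ ∑' k, a k * z ^ k) q 0 := by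
    rw [hasFPowerSeriesAt_iff]
    filter_upwards [Metric.ball_mem_nhds (0 : K) one_pos] with z hz
    have hz1 : ‖z‖ ≤ 1 := (mem_ball_zero_iff.mp hz).le
    have hs : Summable fun k ↦ a k * z ^ k := by
      apply NonarchimedeanAddGroup.summable_of_tendsto_cofinite_zero
      rw [Nat.cofinite_eq_atTop]
      refine squeeze_zero_norm (fun k ↦ ?_) (tendsto_norm_zero.comp ha)
      rw [norm_mul, norm_pow]
      exact mul_le_of_le_one_right (norm_nonneg _) (pow_le_one₀ (norm_nonneg _) hz1)
    simpa [q, FormalMultilinearSeries.coeff_ofScalars, mul_comm] using hs.hasSum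
  have hfreq : ∃ᶠ z in 𝓝[≠] (0 : K), ∑' k, a k * z ^ k = 0 :=
    (tendsto_nhdsWithin_iff.mpr ⟨hx, .of_forall hx0⟩).frequently (.of_forall h)
  have hq0 : q = 0 :=
    hq.eq_zero_of_eventually (hq.analyticAt.frequently_zero_iff_eventually_zero.mp hfreq)
  funext k
  rw [Pi.zero_apply, ← FormalMultilinearSeries.coeff_ofScalars (𝕜 := K) (p := a)]
  exact FormalMultilinearSeries.coeff_eq_zero.mpr (congrFun hq0 k)

/-- In a complete ultrametric field, a null family times monomials in elements of the closed unit
ball is summable. -/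
theorem summable_mul_prod_pow {K : Type*} [NormedField K] [CompleteSpace K]
    [IsUltrametricDist K] {ι : Type*} [Fintype ι] {l : (ι → ℕ) → K}
    (hl : Tendsto l cofinite (𝓝 0)) {y : ι → K} (hy : ∀ i, ‖y i‖ ≤ 1) :
    Summable fun α ↦ l α * ∏ i, y i ^ α i := by
  apply NonarchimedeanAddGroup.summable_of_tendsto_cofinite_zero
  refine squeeze_zero_norm (fun α ↦ ?_) (tendsto_norm_zero.comp hl)
  rw [norm_mul, norm_prod]
  refine mul_le_of_le_one_right (norm_nonneg _)
    (Finset.prod_le_one (fun _ _ ↦ norm_nonneg _) fun i _ ↦ ?_)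
  rw [norm_pow]
  exact pow_le_one₀ (norm_nonneg _) (hy i)

/-- A strictly convergent power series in `n` variables over a complete ultrametric field that
vanishes on the grid `Sⁿ`, where `S` is the set of values of a sequence of nonzero elements of the
closed unit ball tending to `0`, is zero. -/
theorem eq_zero_of_tsum_mul_prod_pow_eq_zero {K : Type*} [NontriviallyNormedField K]
    [CompleteSpace K] [IsUltrametricDist K] {x : ℕ → K} (hx0 : ∀ m, x m ≠ 0)
    (hx1 : ∀ m, ‖x m‖ ≤ 1) (hx : Tendsto x atTop (𝓝 0)) {n : ℕ} {l : (Fin n → ℕ) → K}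
    (hl : Tendsto l cofinite (𝓝 0))
    (h : ∀ β : Fin n → ℕ, ∑' α : Fin n → ℕ, l α * ∏ i, x (β i) ^ α i = 0) : l = 0 := by
  induction n with
  | zero =>
    funext α
    have hα := h α
    rw [tsum_eq_single α fun γ hγ ↦ (hγ (Subsingleton.elim γ α)).elim] at hα
    simpa using hα
  | succ n ih =>
    let e : ℕ × (Fin n → ℕ) ≃ (Fin (n + 1) → ℕ) := Fin.consEquiv fun _ ↦ ℕ
    have he : ∀ k α, e (k, α) = Fin.cons k α := fun _ _ ↦ rfl
    have hsum : ∀ (z : K) (β : Fin n → ℕ), ‖z‖ ≤ 1 → Summable fun q : ℕ × (Fin n → ℕ) ↦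
        z ^ q.1 * (l (e q) * ∏ i, x (β i) ^ q.2 i) := by
      intro z β hz
      have hs := summable_mul_prod_pow hl (y := Fin.cons z fun i ↦ x (β i))
        (Fin.cases hz fun i ↦ hx1 (β i))
      refine (e.summable_iff.mpr hs).congr fun q ↦ ?_
      simp [he, Fin.prod_univ_succ]
      ring
    have hcoeff : ∀ k, (fun α ↦ l (e (k, α))) = 0 := by
      intro k
      refine ih (hl.comp (e.injective.comp (Prod.mk_right_injective k)).tendsto_cofinite)
        fun β ↦ ?_
      have hnull : Tendsto (fun k ↦ ∑' α, l (e (k, α)) * ∏ i, x (β i) ^ α i) atTop (𝓝 0) := by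
        simpa using (hsum 1 β (by simp)).prod.tendsto_atTop_zero
      refine congrFun (coeff_eq_zero_of_tsum_eq_zero hnull hx0 hx fun m ↦ ?_) k
      rw [← h (Fin.cons m β), ← e.tsum_eq]
      have hprod := (hsum (x m) β (hx1 m)).tsum_prod
      calc _ = ∑' k, ∑' α, x m ^ k * (l (e (k, α)) * ∏ i, x (β i) ^ α i) := by
            simp_rw [tsum_mul_left, mul_comm]
        _ = _ := by
            rw [← hprod]
            refine tsum_congr fun q ↦ ?_
            simp [he, Fin.prod_univ_succ]
            ring
    funext α
    obtain ⟨⟨k, α⟩, rfl⟩ := e.surjective α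
    exact congrFun (hcoeff k) _


/-- The affinoid enveloping algebra of the Cartan subalgebra acts faithfully on polynomials:
over a finite extension `K` of `ℚ_p` (for `p` an odd prime), if `λ : ℕⁿ → K` tends to `0`
(only finitely many `α` with `‖λ_α‖ ≥ ε` for each `ε > 0`) and for every `β ∈ ℕⁿ` the
convergent sum `∑'_α λ_α ∏ᵢ (-1/2 - βᵢ)^{αᵢ}` vanishes, then `λ = 0`. -/
theorem cartan_affinoid_faithful (p : ℕ) [Fact p.Prime] (hp : Odd p)
    {K : Type*} [NontriviallyNormedField K] [NormedAlgebra ℚ_[p] K] [CompleteSpace K]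
    [FiniteDimensional ℚ_[p] K]
    (hiso : ∀ x : ℚ_[p], ‖algebraMap ℚ_[p] K x‖ = ‖x‖)
    (hna : ∀ x y : K, ‖x + y‖ ≤ max ‖x‖ ‖y‖)
    {n : ℕ} (hn : 1 ≤ n) (l : (Fin n → ℕ) → K)
    (hl : Filter.Tendsto l Filter.cofinite (nhds 0))
    (h : ∀ β : Fin n → ℕ,
      ∑' α : Fin n → ℕ, l α * ∏ i, (-(1 / 2 : K) - (β i : K)) ^ α i = 0) :
    l = 0 := by
  have : IsUltrametricDist K :=
    IsUltrametricDist.isUltrametricDist_of_forall_norm_add_le_max_norm hna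
  have : CharZero K := charZero_of_injective_algebraMap (algebraMap ℚ_[p] K).injective
  have hpn : ‖(p : K)‖ = (p : ℝ)⁻¹ := by
    simpa using hiso (p : ℚ_[p])
  have hp1 : 1 < (p : ℝ) := by exact_mod_cast (Fact.out : p.Prime).one_lt
  have hp0 : (p : K) ≠ 0 := by exact_mod_cast (Fact.out : p.Prime).ne_zero
  have h2 : ‖(2 : K)‖ = 1 := by
    have h2p : ‖((2 : ℕ) : ℚ_[p])‖ = 1 := by
      rw [Padic.norm_natCast_eq_one_iff]
      exact hp.coprime_two_right
    simpa only [map_ofNat, Nat.cast_ofNat] using (hiso ((2 : ℕ) : ℚ_[p])).trans h2p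
  have hnorm : ∀ m : ℕ, ‖-((p : K) ^ m / 2)‖ = (p : ℝ)⁻¹ ^ m := by
    intro m
    rw [norm_neg, norm_div, norm_pow, hpn, h2, div_one]
  -- The points `-1/2 - (p ^ m - 1) / 2 = -p ^ m / 2` accumulate at `0`.
  refine eq_zero_of_tsum_mul_prod_pow_eq_zero (x := fun m ↦ -((p : K) ^ m / 2)) (fun m ↦ ?_)
    (fun m ↦ ?_) ?_ hl fun β ↦ ?_
  · exact neg_ne_zero.mpr (div_ne_zero (pow_ne_zero _ hp0) two_ne_zero)
  · rw [hnorm]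
    exact pow_le_one₀ (by positivity) (inv_le_one_of_one_le₀ hp1.le)
  · rw [tendsto_zero_iff_norm_tendsto_zero]
    simp_rw [hnorm]
    exact tendsto_pow_atTop_nhds_zero_of_lt_one (by positivity) (inv_lt_one_of_one_lt₀ hp1)
  · choose b hb using fun m : ℕ ↦ hp.pow (n := m)
    have hpt : ∀ m, -((p : K) ^ m / 2) = -(1 / 2 : K) - (b m : K) := by
      intro m
      have hbm : (p : K) ^ m = 2 * b m + 1 := by exact_mod_cast hb m
      rw [hbm]
      field_simp
      ring
    simp_rw [hpt]
    exact h fun i ↦ b (β i)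
end

section
/- The Iwasawa algebra of the torus acts faithfully on polynomials, in the following sense: let λ : ℕⁿ → K be a bounded family (i.e., {‖λ_α‖ : α ∈ ℕⁿ} is bounded). Suppose that for every β ∈ ℕⁿ the convergent sum ∑'_{α ∈ ℕⁿ} λ_α · ∏_{i=1}^n (exp(p·(−1/2 − β_i)) − 1)^{α_i} equals 0 in K, where exp(x) := ∑_{k≥0} x^k/k! is the p-adic exponential (which converges at p·(−1/2 − β_i) since p is odd, and ‖exp(p·(−1/2 − β_i)) − 1‖ ≤ 1/p). Then λ is identically zero. -/
open Filter Topology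

/-- A power series with bounded coefficients whose zeros accumulate at a point of norm less than
`1 / 2` is zero. -/
theorem eq_zero_of_frequently_tsum_mul_pow_eq_zero {K : Type*} [NontriviallyNormedField K]
    [CompleteSpace K] {a : ℕ → K} {C : ℝ} (ha : ∀ k, ‖a k‖ ≤ C) {w : K} (hw : ‖w‖ < 1 / 2)
    (hz : ∃ᶠ z in 𝓝[≠] w, ∑' k, a k * z ^ k = 0) : a = 0 := by
  set P := FormalMultilinearSeries.ofScalars K a with hP
  have hrad : (1 : ENNReal) ≤ P.radius := by
    simpa using P.le_radius_of_bound C (r := 1) (by simpa [hP] using ha)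
  have hball : HasFPowerSeriesOnBall P.sum P 0 1 :=
    (P.hasFPowerSeriesOnBall (zero_lt_one.trans_le hrad)).mono zero_lt_one hrad
  have hsum (z : K) : P.sum z = ∑' k, a k * z ^ k :=
    FormalMultilinearSeries.ofScalars_sum_eq a z
  have hw1 : (‖w‖₊ : ENNReal) < 1 := by
    rw [← ENNReal.coe_one, ENNReal.coe_lt_coe, ← NNReal.coe_lt_coe]
    simp only [coe_nnnorm, NNReal.coe_one]
    linarith
  have hball' := hball.changeOrigin hw1
  rw [zero_add] at hball'
  have hseries : P.changeOrigin w = 0 :=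
    hball'.hasFPowerSeriesAt.eq_zero_of_eventually
      (hball'.analyticAt.frequently_zero_iff_eventually_zero.1 (by simpa only [hsum] using hz))
  rw [hseries] at hball'
  have hnear : ∀ᶠ z in 𝓝 (0 : K), P.sum z = 0 := by
    have hopen : IsOpen {z : K | ‖z - w‖ < 1 / 2} :=
      isOpen_lt (by fun_prop) continuous_const
    filter_upwards [hopen.mem_nhds (by simpa using hw)] with z hzw
    have hmem : z - w ∈ Metric.eball (0 : K) (1 - ‖w‖₊) := by
      rw [Metric.mem_eball, edist_zero_right, enorm_eq_nnnorm, ← ENNReal.coe_one,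
        ← ENNReal.coe_sub, ENNReal.coe_lt_coe, lt_tsub_iff_right, ← NNReal.coe_lt_coe]
      simp only [NNReal.coe_add, coe_nnnorm, NNReal.coe_one]
      have : ‖z - w‖ < 1 / 2 := hzw
      linarith
    have hval := hball'.hasSum hmem
    rw [add_sub_cancel] at hval
    exact hval.unique (by simp)
  exact (FormalMultilinearSeries.ofScalars_series_eq_zero K).1
    (hball.hasFPowerSeriesAt.eq_zero_of_eventually hnear)

theorem summable_prod_pow {r : ℝ} (hr0 : 0 ≤ r) (hr1 : r < 1) (n : ℕ) :
    Summable fun α : Fin n → ℕ => ∏ i, r ^ α i := by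
  induction n with
  | zero => exact Summable.of_finite
  | succ n ih =>
    rw [← (Fin.consEquiv fun _ : Fin (n + 1) => ℕ).summable_iff]
    refine ((summable_geometric_of_lt_one hr0 hr1).mul_of_nonneg ih
      (fun _ => by positivity) (fun _ => by positivity)).congr fun x => ?_
    simp [Fin.consEquiv, Fin.prod_univ_succ]

/-- A power series in several variables with bounded coefficients that vanishes on the grid of a
sequence accumulating at a point of norm less than `1 / 2` is zero. -/
theorem eq_zero_of_tsum_mul_prod_pow_eq_zero_s7 {K : Type*} [NontriviallyNormedField K]
    [CompleteSpace K] {z : ℕ → K} {r : ℝ} (hr : r < 1 / 2) (hzr : ∀ b, ‖z b‖ ≤ r)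
    (hz : ∃ᶠ x in 𝓝[≠] (z 0), x ∈ Set.range z) {n : ℕ} {l : (Fin n → ℕ) → K} {C : ℝ}
    (hl : ∀ α, ‖l α‖ ≤ C)
    (h : ∀ β : Fin n → ℕ, ∑' α : Fin n → ℕ, l α * ∏ i, z (β i) ^ α i = 0) : l = 0 := by
  have hr0 : 0 ≤ r := (norm_nonneg _).trans (hzr 0)
  have hr1 : r < 1 := by linarith
  induction n generalizing C with
  | zero =>
    funext α
    have h0 := h α
    rw [tsum_eq_single α fun b hb => (hb (Subsingleton.elim _ _)).elim] at h0
    simpa using h0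
  | succ n ih =>
    have hC : 0 ≤ C := (norm_nonneg _).trans (hl 0)
    have hbound (m : ℕ) (β α : Fin m → ℕ) (c : K) (hc : ‖c‖ ≤ C) :
        ‖c * ∏ i, z (β i) ^ α i‖ ≤ C * ∏ i, r ^ α i := by
      rw [norm_mul, norm_prod]
      gcongr with i
      rw [norm_pow]
      gcongr
      exact hzr _
    have hsummable (m : ℕ) (β : Fin m → ℕ) (c : (Fin m → ℕ) → K) (hc : ∀ α, ‖c α‖ ≤ C) :
        Summable fun α => c α * ∏ i, z (β i) ^ α i :=
      Summable.of_norm_bounded ((summable_prod_pow hr0 hr1 m).mul_left C)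
        fun α => hbound m β α _ (hc α)
    have hslice (β : Fin n → ℕ) :
        (fun k => ∑' α : Fin n → ℕ, l (Fin.cons k α) * ∏ i, z (β i) ^ α i) = 0 := by
      refine eq_zero_of_frequently_tsum_mul_pow_eq_zero (C := ∑' α : Fin n → ℕ, C * ∏ i, r ^ α i)
        (fun k => tsum_of_norm_bounded ((summable_prod_pow hr0 hr1 n).mul_left C).hasSum
          fun α => hbound n β α _ (hl _)) ((hzr 0).trans_lt hr) (hz.mono ?_)
      rintro _ ⟨b, rfl⟩
      have hb := h (Fin.cons b β)
      have hs := hsummable (n + 1) (Fin.cons b β) l hl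
      rw [← (Fin.consEquiv fun _ : Fin (n + 1) => ℕ).tsum_eq] at hb
      rw [← (Fin.consEquiv fun _ : Fin (n + 1) => ℕ).summable_iff] at hs
      rw [Summable.tsum_prod (by exact hs)] at hb
      rw [← hb]
      refine tsum_congr fun k => ?_
      rw [← tsum_mul_right]
      refine tsum_congr fun α => ?_
      simp only [Fin.consEquiv, Equiv.coe_fn_mk, Fin.prod_univ_succ, Fin.cons_zero, Fin.cons_succ]
      ring
    funext α
    have hk : (fun α' : Fin n → ℕ => l (Fin.cons (α 0) α')) = 0 :=
      ih (fun α' => hl _) fun β => congrFun (hslice β) (α 0)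
    simpa using congrFun hk (Fin.tail α)

section PadicExp

variable {p : ℕ} [Fact p.Prime] {K : Type*} [NontriviallyNormedField K] [NormedAlgebra ℚ_[p] K]

theorem norm_natCast_factorial_inv_le (hp : Odd p)
    (hiso : ∀ x : ℚ_[p], ‖algebraMap ℚ_[p] K x‖ = ‖x‖) (k : ℕ) :
    ‖(k.factorial : K)‖⁻¹ ≤ (p : ℝ) ^ ((k - 1) / 2) := by
  have hprime : p.Prime := Fact.out
  have hp3 : 3 ≤ p := by
    have := hprime.two_le
    obtain ⟨m, rfl⟩ := hp
    omega
  have hval : padicValNat p k.factorial ≤ (k - 1) / 2 := by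
    rcases eq_or_ne k 0 with rfl | hk
    · simp
    have hlt := sub_one_mul_padicValNat_factorial_lt_of_ne_zero (p := p) hk
    have : 2 * padicValNat p k.factorial ≤ (p - 1) * padicValNat p k.factorial :=
      Nat.mul_le_mul_right _ (by omega)
    omega
  have hnorm : ‖(k.factorial : K)‖ = ‖(k.factorial : ℚ_[p])‖ := by rw [← hiso, map_natCast]
  rw [hnorm, Padic.norm_eq_zpow_neg_valuation (by exact_mod_cast k.factorial_ne_zero),
    Padic.valuation_natCast, zpow_neg, inv_inv, zpow_natCast]
  exact pow_le_pow_right₀ (by exact_mod_cast hprime.one_le) hval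

theorem summable_pow_div_factorial [CompleteSpace K] [IsUltrametricDist K] (hp : Odd p)
    (hiso : ∀ x : ℚ_[p], ‖algebraMap ℚ_[p] K x‖ = ‖x‖) {x : K} (hx : ‖x‖ ≤ (p : ℝ)⁻¹) :
    Summable fun k : ℕ => x ^ k / (k.factorial : K) := by
  have hp1 : (1 : ℝ) < p := by exact_mod_cast (Fact.out : p.Prime).one_lt
  refine NonarchimedeanAddGroup.summable_of_tendsto_cofinite_zero ?_
  rw [Nat.cofinite_eq_atTop]
  refine squeeze_zero_norm (a := fun k : ℕ => ((p : ℝ)⁻¹) ^ (k / 2)) (fun k => ?_)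
    ((tendsto_pow_atTop_nhds_zero_of_lt_one (by positivity) (inv_lt_one_of_one_lt₀ hp1)).comp
      (Nat.tendsto_div_const_atTop two_ne_zero))
  rw [norm_div, norm_pow, div_eq_mul_inv]
  calc ‖x‖ ^ k * ‖(k.factorial : K)‖⁻¹
      ≤ ((p : ℝ)⁻¹) ^ k * (p : ℝ) ^ ((k - 1) / 2) := by
        gcongr
        exact norm_natCast_factorial_inv_le hp hiso k
    _ ≤ ((p : ℝ)⁻¹) ^ k * (p : ℝ) ^ (k - k / 2) := by
        gcongr
        · exact hp1.le
        · omega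
    _ = ((p : ℝ)⁻¹) ^ (k / 2) := by
        have hk : ((p : ℝ)⁻¹) ^ k = ((p : ℝ)⁻¹) ^ (k / 2) * ((p : ℝ)⁻¹) ^ (k - k / 2) := by
          rw [← pow_add]
          congr 1
          omega
        rw [hk, mul_assoc, ← mul_pow, inv_mul_cancel₀ (by positivity), one_pow, mul_one]

/-- The `p`-adic exponential is an isometry on the closed ball of radius `1 / p`. -/
theorem norm_tsum_pow_div_factorial_sub [CompleteSpace K] [IsUltrametricDist K] (hp : Odd p)
    (hiso : ∀ x : ℚ_[p], ‖algebraMap ℚ_[p] K x‖ = ‖x‖) {x y : K} (hx : ‖x‖ ≤ (p : ℝ)⁻¹)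
    (hy : ‖y‖ ≤ (p : ℝ)⁻¹) :
    ‖(∑' k : ℕ, x ^ k / (k.factorial : K)) - ∑' k : ℕ, y ^ k / (k.factorial : K)‖ = ‖x - y‖ := by
  have hp1 : (1 : ℝ) < p := by exact_mod_cast (Fact.out : p.Prime).one_lt
  have hsx := summable_pow_div_factorial hp hiso hx
  have hsy := summable_pow_div_factorial hp hiso hy
  rcases eq_or_ne x y with rfl | hxy
  · simp
  rw [← hsx.tsum_sub hsy, ← (hsx.sub hsy).sum_add_tsum_nat_add 2]
  have htail : ‖∑' k : ℕ, (x ^ (k + 2) / ((k + 2).factorial : K)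
      - y ^ (k + 2) / ((k + 2).factorial : K))‖ ≤ ‖x - y‖ * (p : ℝ)⁻¹ := by
    refine IsUltrametricDist.norm_tsum_le_of_forall_le_of_nonneg (by positivity) fun k => ?_
    rw [← sub_div, ← (Commute.all x y).mul_geom_sum₂, norm_div, norm_mul, mul_div_assoc,
      div_eq_mul_inv]
    gcongr
    have hgeom : ‖∑ i ∈ Finset.range (k + 2), x ^ i * y ^ (k + 2 - 1 - i)‖
        ≤ ((p : ℝ)⁻¹) ^ (k + 1) := by
      refine IsUltrametricDist.norm_sum_le_of_forall_le_of_nonneg (by positivity) fun i hi => ?_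
      have hi' := Finset.mem_range.1 hi
      rw [norm_mul, norm_pow, norm_pow]
      calc ‖x‖ ^ i * ‖y‖ ^ (k + 2 - 1 - i)
          ≤ ((p : ℝ)⁻¹) ^ i * ((p : ℝ)⁻¹) ^ (k + 2 - 1 - i) := by gcongr
        _ = ((p : ℝ)⁻¹) ^ (k + 1) := by
          rw [← pow_add]
          congr 1
          omega
    calc _ ≤ ((p : ℝ)⁻¹) ^ (k + 1) * (p : ℝ) ^ k := by
          gcongr
          refine (norm_natCast_factorial_inv_le hp hiso (k + 2)).trans ?_
          exact pow_le_pow_right₀ hp1.le (by omega)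
      _ = (p : ℝ)⁻¹ := by
          rw [pow_succ', mul_assoc, ← mul_pow, inv_mul_cancel₀ (by positivity), one_pow, mul_one]
  have hlt : ‖x - y‖ * (p : ℝ)⁻¹ < ‖x - y‖ :=
    mul_lt_of_lt_one_right (norm_pos_iff.2 (sub_ne_zero.2 hxy)) (inv_lt_one_of_one_lt₀ hp1)
  have hhead : ∑ k ∈ Finset.range 2, (x ^ k / (k.factorial : K) - y ^ k / (k.factorial : K))
      = x - y := by
    simp [Finset.sum_range_succ]
  have hlt' := htail.trans_lt hlt
  rw [hhead, IsUltrametricDist.norm_add_eq_max_of_norm_ne_norm hlt'.ne', max_eq_left hlt'.le]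

end PadicExp


/-- The Iwasawa algebra of the torus acts faithfully on polynomials: over a finite extension
`K` of `ℚ_p` (for `p` an odd prime), if `λ : ℕⁿ → K` is a bounded family and for every
`β ∈ ℕⁿ` the convergent sum `∑'_α λ_α ∏ᵢ (exp(p(-1/2 - βᵢ)) - 1)^{αᵢ}` vanishes, where
`exp x = ∑ₖ x^k/k!` is the `p`-adic exponential, then `λ = 0`. -/
theorem torus_iwasawa_faithful (p : ℕ) [Fact p.Prime] (hp : Odd p)
    {K : Type*} [NontriviallyNormedField K] [NormedAlgebra ℚ_[p] K] [CompleteSpace K]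
    [FiniteDimensional ℚ_[p] K]
    (hiso : ∀ x : ℚ_[p], ‖algebraMap ℚ_[p] K x‖ = ‖x‖)
    (hna : ∀ x y : K, ‖x + y‖ ≤ max ‖x‖ ‖y‖)
    {n : ℕ} (hn : 1 ≤ n) (l : (Fin n → ℕ) → K)
    (hl : ∃ C : ℝ, ∀ α, ‖l α‖ ≤ C)
    (h : ∀ β : Fin n → ℕ,
      ∑' α : Fin n → ℕ, l α *
        ∏ i, ((∑' k : ℕ, ((p : K) * (-(1 / 2 : K) - (β i : K))) ^ k / (k.factorial : K)) - 1)
          ^ α i = 0) :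
    l = 0 := by
  have : IsUltrametricDist K :=
    IsUltrametricDist.isUltrametricDist_of_forall_norm_add_le_max_norm hna
  have hprime : p.Prime := Fact.out
  have hp3 : 3 ≤ p := by
    have := hprime.two_le
    obtain ⟨m, rfl⟩ := hp
    omega
  have hp3' : (3 : ℝ) ≤ p := by exact_mod_cast hp3
  have hnat (m : ℕ) : ‖(m : K)‖ = ‖(m : ℚ_[p])‖ := by rw [← hiso, map_natCast]
  have hnormp : ‖(p : K)‖ = (p : ℝ)⁻¹ := by rw [hnat, Padic.norm_p]
  have hnat_le (m : ℕ) : ‖(m : K)‖ ≤ 1 := by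
    rw [hnat]
    exact_mod_cast Padic.norm_int_le_one (p := p) m
  have hnorm2 : ‖(2 : K)‖ = 1 := by
    have := hnat 2
    rw [Padic.norm_natCast_eq_one_iff.2 hp.coprime_two_right] at this
    exact_mod_cast this
  set x : ℕ → K := fun b => (p : K) * (-(1 / 2 : K) - (b : K)) with hxdef
  set z : ℕ → K := fun b => (∑' k : ℕ, x b ^ k / (k.factorial : K)) - 1 with hzdef
  have hx (b : ℕ) : ‖x b‖ ≤ (p : ℝ)⁻¹ := by
    rw [hxdef, norm_mul, hnormp]
    refine mul_le_of_le_one_right (by positivity) ?_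
    rw [sub_eq_add_neg]
    refine (hna _ _).trans (max_le ?_ ?_)
    · simp [hnorm2]
    · simpa using hnat_le b
  have hz_sub (a b : ℕ) : ‖z a - z b‖ = ‖x a - x b‖ := by
    rw [hzdef, sub_sub_sub_cancel_right, norm_tsum_pow_div_factorial_sub hp hiso (hx a) (hx b)]
  have hz_le (b : ℕ) : ‖z b‖ ≤ (p : ℝ)⁻¹ := by
    have h0 : ∑' k : ℕ, (0 : K) ^ k / (k.factorial : K) = 1 := by
      rw [tsum_eq_single 0 fun k hk => by simp [hk]]
      simp
    have hb := norm_tsum_pow_div_factorial_sub hp hiso (hx b) (y := 0) (by simp)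
    rw [h0, sub_zero] at hb
    exact hb.trans_le (hx b)
  have hx_sub (m : ℕ) : x (p ^ m) - x 0 = -(p : K) ^ (m + 1) := by
    simp only [hxdef]
    push_cast
    ring
  have hz_norm (m : ℕ) : ‖z (p ^ m) - z 0‖ = ((p : ℝ)⁻¹) ^ (m + 1) := by
    rw [hz_sub, hx_sub, norm_neg, norm_pow, hnormp]
  have hlim : Tendsto (fun m => z (p ^ m)) atTop (𝓝[≠] (z 0)) := by
    refine tendsto_nhdsWithin_iff.2 ⟨?_, Eventually.of_forall fun m hm => ?_⟩
    · rw [tendsto_iff_norm_sub_tendsto_zero]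
      simp only [hz_norm]
      exact (tendsto_pow_atTop_nhds_zero_of_lt_one (by positivity)
        (inv_lt_one_of_one_lt₀ (by linarith))).comp (tendsto_add_atTop_nat 1)
    · have hm' := hz_norm m
      rw [Set.mem_singleton_iff.1 hm, sub_self, norm_zero] at hm'
      exact (pow_pos (inv_pos.2 (by linarith : (0 : ℝ) < p)) (m + 1)).ne hm'
  obtain ⟨C, hC⟩ := hl
  refine eq_zero_of_tsum_mul_prod_pow_eq_zero_s7 (z := z) (r := (p : ℝ)⁻¹) ?_ hz_le
    (hlim.frequently (Frequently.of_forall fun m => ⟨p ^ m, rfl⟩)) hC h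
  rw [one_div]
  exact inv_strictAnti₀ two_pos (by linarith)
end

section
/- Fix 2 ≤ k ≤ n and let μ be any K-valued function of pairs (α, β) with α = (α₁,…,α_{k−1}) ∈ ℕ^{k−1} and β = (β_{k+1},…,β_n) ∈ ℕ^{n−k}. Suppose that for every γ ∈ ℕⁿ and every δ ∈ ℤⁿ the finite sum of μ(α,β) · γ_k(γ_k−1)⋯(γ_k−|α|+1) · ∏_{j=k+1}^n γ_j(γ_j−1)⋯(γ_j−β_j+1), taken over all (α, β) with |α| ≤ γ_k, β_j ≤ γ_j for k+1 ≤ j ≤ n, and γ + (α₁+|β|)e₁ + α₂e₂ + ⋯ + α_{k−1}e_{k−1} − |α|e_k − β_{k+1}e_{k+1} − ⋯ − β_n e_n = δ, equals zero (this sum is the coefficient of X^δ in the formal application of ∑_{α,β} μ(α,β)·(X₁∂_k)^{α₁}⋯(X_{k−1}∂_k)^{α_{k−1}}(X₁∂_{k+1})^{β_{k+1}}⋯(X₁∂_n)^{β_n} to the monomial X^γ). Then μ is identically zero. -/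
/-- The change of exponent effected by the operator of index `(α, β)` on a monomial. -/
def exponentShift (n k : ℕ) (α : Fin (k - 1) → ℕ) (β : Fin (n - k) → ℕ) (i : Fin n) : ℤ :=
  if h1 : i.val < k - 1 then
    (α ⟨i.val, h1⟩ : ℤ) + (if i.val = 0 then ∑ s, (β s : ℤ) else 0)
  else if h2 : i.val = k - 1 then -(∑ t, (α t : ℤ))
  else -(β ⟨i.val - k, by have := i.isLt; omega⟩ : ℤ)

/-- Distinct operators shift exponents differently. -/
theorem exponentShift_injective {n k : ℕ} (hk : 2 ≤ k) (hkn : k ≤ n)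
    {α α' : Fin (k - 1) → ℕ} {β β' : Fin (n - k) → ℕ}
    (h : ∀ i, exponentShift n k α β i = exponentShift n k α' β' i) : α = α' ∧ β = β' := by
  have hβ : β = β' := by
    funext s
    have hs := h ⟨s.val + k, by have := s.isLt; omega⟩
    have h1 : ¬ s.val + k < k - 1 := by omega
    have h2 : s.val + k ≠ k - 1 := by omega
    simpa [exponentShift, h1, h2] using hs
  subst hβ
  refine ⟨funext fun t => ?_, rfl⟩
  have ht := h ⟨t.val, by have := t.isLt; omega⟩
  simpa [exponentShift, t.isLt] using ht

/-- Step 1 of Lemma "Induction base case": the (affinoid) algebra generated by the operators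
`Xᵢ∂ₖ` (`1 ≤ i ≤ k-1`) and `X₁∂ⱼ` (`k+1 ≤ j ≤ n`) acts faithfully on polynomials.  Stated
combinatorially (0-indexed: variable `X_k` of the paper is the variable with index `k-1`,
`α` is indexed by `Fin (k-1)` for the paper indices `1, …, k-1` and `β` by `Fin (n-k)` for
the paper indices `k+1, …, n`): if, for every `γ ∈ ℕⁿ` and `δ ∈ ℤⁿ`, the coefficient of
`X^δ` in the formal application of `∑ μ(α,β) (X₁∂ₖ)^{α₁}⋯(X_{k-1}∂ₖ)^{α_{k-1}}
(X₁∂_{k+1})^{β_{k+1}}⋯(X₁∂ₙ)^{βₙ}` to `X^γ` vanishes, then `μ = 0`. -/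
theorem step_one_faithful {K : Type*} [Field K] [CharZero K] (n k : ℕ)
    (hk2 : 2 ≤ k) (hkn : k ≤ n)
    (μ : (Fin (k - 1) → ℕ) × (Fin (n - k) → ℕ) → K)
    (h : ∀ (γ : Fin n → ℕ) (δ : Fin n → ℤ),
      ∑ α ∈ Finset.Iic (fun _ : Fin (k - 1) => γ ⟨k - 1, by omega⟩),
        ∑ β ∈ Finset.Iic (fun s : Fin (n - k) => γ ⟨s.val + k, by have := s.isLt; omega⟩),
          (if ((∑ t, α t) ≤ γ ⟨k - 1, by omega⟩ ∧
              ∀ i : Fin n, δ i = (γ i : ℤ) +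
                (if h1 : i.val < k - 1 then
                  (α ⟨i.val, h1⟩ : ℤ) + (if i.val = 0 then ∑ s, (β s : ℤ) else 0)
                 else if h2 : i.val = k - 1 then -(∑ t, (α t : ℤ))
                 else -(β ⟨i.val - k, by have := i.isLt; omega⟩ : ℤ)))
            then μ (α, β) * ((γ ⟨k - 1, by omega⟩).descFactorial (∑ t, α t) : K) *
              ∏ s : Fin (n - k),
                ((γ ⟨s.val + k, by have := s.isLt; omega⟩).descFactorial (β s) : K)
            else 0) = 0) :
    μ = 0 := by
  funext ⟨α₀, β₀⟩
  let γ : Fin n → ℕ := fun i =>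
    if h1 : i.val < k - 1 then 0
    else if h2 : i.val = k - 1 then ∑ t, α₀ t
    else β₀ ⟨i.val - k, by have := i.isLt; omega⟩
  have hγk : γ ⟨k - 1, by omega⟩ = ∑ t, α₀ t := by simp [γ]
  have hγβ (s : Fin (n - k)) : γ ⟨s.val + k, by have := s.isLt; omega⟩ = β₀ s := by
    have h1 : ¬ s.val + k < k - 1 := by omega
    have h2 : s.val + k ≠ k - 1 := by omega
    simp [γ, h1, h2]
  have key := h γ fun i => (γ i : ℤ) + exponentShift n k α₀ β₀ i
  simp only [hγk, hγβ] at key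
  rw [Finset.sum_eq_single α₀, Finset.sum_eq_single β₀, if_pos ⟨le_rfl, fun _ => rfl⟩] at key
  · have hne : ((∑ t, α₀ t).descFactorial (∑ t, α₀ t) : K) *
        ∏ s, ((β₀ s).descFactorial (β₀ s) : K) ≠ 0 := by
      simp [Nat.descFactorial_self, Finset.prod_ne_zero_iff, Nat.factorial_ne_zero]
    rw [mul_assoc] at key
    exact (mul_eq_zero.mp key).resolve_right hne
  · intro β _ hβ
    refine if_neg fun hc => hβ ?_
    exact (exponentShift_injective hk2 hkn fun i => add_left_cancel (hc.2 i)).2.symm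
  · exact fun hβ => absurd (Finset.mem_Iic.mpr le_rfl) hβ
  · intro α _ hα
    refine Finset.sum_eq_zero fun β _ => if_neg fun hc => hα ?_
    exact (exponentShift_injective hk2 hkn fun i => add_left_cancel (hc.2 i)).1.symm
  · refine fun hα => absurd (Finset.mem_Iic.mpr fun t => ?_) hα
    exact Finset.single_le_sum (fun _ _ => Nat.zero_le _) (Finset.mem_univ t)
end

section
/- The metaplectic representation is injective on the Iwasawa algebra of the group B, in the following concrete sense: for 1 ≤ i ≤ j ≤ n let F_{ij} be the endomorphism of K[X₁,…,Xₙ] given by F_{ij}f := ∑_{k≥1} (p^k/k!)·(∂_i∂_j)^k f (a finite sum, since ∂_i∂_j lowers total degree by 2); these operators pairwise commute, and for α ∈ ℕ^S write F^α := ∏_{i≤j} F_{ij}^{α_{ij}}, noting that F^α f = 0 whenever 2|α| > deg f. If λ : ℕ^S → K is a bounded family such that for every f ∈ K[X₁,…,Xₙ] the (finite) sum ∑_α λ_α · F^α f equals 0, then λ is identically zero. -/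
open MvPolynomial

/-- The operator `F_{ij} : f ↦ ∑_{k ≥ 1} (p^k / k!) (∂ᵢ∂ⱼ)^k f` on `K[X₁, …, Xₙ]`
(a finite sum, since `∂ᵢ∂ⱼ` lowers the total degree by 2). -/
noncomputable def Fop (p : ℕ) (K : Type*) [Field K] {n : ℕ} (i j : Fin n) :
    Function.End (MvPolynomial (Fin n) K) := fun f =>
  ∑ k ∈ Finset.Icc 1 f.totalDegree,
    ((p : K) ^ k / (k.factorial : K)) •
      ((((pderiv i).toLinearMap * (pderiv j).toLinearMap :
          Module.End K (MvPolynomial (Fin n) K)) ^ k) f)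

/-- `F^α = ∏_{i ≤ j} F_{ij}^{α_{ij}}`, the factors composed in a fixed order. -/
noncomputable def FopPow (p : ℕ) (K : Type*) [Field K] {n : ℕ}
    (α : {q : Fin n × Fin n // q.1 ≤ q.2} → ℕ) :
    Function.End (MvPolynomial (Fin n) K) :=
  (((List.finRange n).flatMap (fun i => (List.finRange n).flatMap (fun j =>
      if h : i ≤ j then [(⟨(i, j), h⟩ : {q : Fin n × Fin n // q.1 ≤ q.2})] else []))).map
    (fun s => Fop p K s.1.1 s.1.2 ^ α s)).prod

/-- Among the members of a nonempty set of exponents there is one whose weight `∑ αₛ Q ^ eₛ` is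
strictly smallest as soon as `Q` is large enough. -/
lemma exists_min_weight {ι : Type*} [Fintype ι] (e : ι → ℕ) (he : Function.Injective e)
    (B : Set (ι → ℕ)) (hB : B.Nonempty) :
    ∃ α ∈ B, ∀ Q, ∑ s, α s < Q → ∀ β ∈ B, β ≠ α →
      ∑ s, α s * Q ^ e s < ∑ s, β s * Q ^ e s := by
  classical
  let _ : LinearOrder ι := LinearOrder.lift' (fun s => OrderDual.toDual (e s)) he
  have hlt : ∀ s t : ι, s < t ↔ e t < e s := fun s t => Iff.rfl
  have hwf : WellFounded (Pi.Lex (· < ·) (fun {_ : ι} (a b : ℕ) => a < b)) :=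
    Pi.Lex.wellFounded (· < ·) fun _ => wellFounded_lt
  obtain ⟨α, hα, hmin⟩ := hwf.has_min B hB
  refine ⟨α, hα, fun Q hQ β hβ hne => ?_⟩
  have hlex : Pi.Lex (· < ·) (fun {_ : ι} (a b : ℕ) => a < b) α β := by
    by_contra hcon
    have htri := Pi.trichotomous_lex (β := fun _ : ι => ℕ) (· < ·)
      (fun {_ : ι} (a b : ℕ) => a < b) wellFounded_lt
    exact hne (htri.trichotomous β α (hmin β hβ) hcon)
  obtain ⟨s, hs, hlt_s⟩ := hlex
  have hQ0 : 0 < Q := by omega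
  have htail : ∑ t with s < t, α t * Q ^ e t < Q ^ e s := by
    rcases (Finset.univ.filter (s < ·)).eq_empty_or_nonempty with h0 | ⟨t₀, ht₀⟩
    · rw [h0, Finset.sum_empty]
      positivity
    · have hpos : 0 < e s := by
        have := (hlt s t₀).1 (by simpa using ht₀)
        omega
      calc ∑ t with s < t, α t * Q ^ e t ≤ ∑ t with s < t, α t * Q ^ (e s - 1) := by
            refine Finset.sum_le_sum fun t ht => ?_
            have := (hlt s t).1 (by simpa using ht)
            gcongr
            omega
        _ = (∑ t with s < t, α t) * Q ^ (e s - 1) := by rw [Finset.sum_mul]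
        _ ≤ (∑ t, α t) * Q ^ (e s - 1) := by
            gcongr
            simp
        _ < Q * Q ^ (e s - 1) := by gcongr
        _ = Q ^ e s := by rw [← pow_succ', Nat.sub_add_cancel hpos]
  have hsplit : ∀ γ : ι → ℕ, ∑ t, γ t * Q ^ e t =
      ∑ t with t < s, γ t * Q ^ e t + γ s * Q ^ e s + ∑ t with s < t, γ t * Q ^ e t := by
    intro γ
    rw [← Finset.sum_filter_add_sum_filter_not Finset.univ (· < s), add_assoc]
    congr 1
    have : Finset.univ.filter (fun t => ¬ t < s) = insert s (Finset.univ.filter (s < ·)) := by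
      ext t
      simp [le_iff_eq_or_lt, eq_comm]
    rw [this, Finset.sum_insert (by simp)]
  have hhead : ∑ t with t < s, α t * Q ^ e t = ∑ t with t < s, β t * Q ^ e t :=
    Finset.sum_congr rfl fun t ht => by rw [hs t (by simpa using ht)]
  have hmid : α s * Q ^ e s + Q ^ e s ≤ β s * Q ^ e s := by
    rw [← Nat.succ_mul]
    exact Nat.mul_le_mul_right _ hlt_s
  rw [hsplit α, hsplit β, hhead]
  omega

lemma three_pow_add_three_pow_injective (n : ℕ) :
    Function.Injective fun s : {q : Fin n × Fin n // q.1 ≤ q.2} =>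
      3 ^ (s.1.1 : ℕ) + 3 ^ (s.1.2 : ℕ) := by
  have aux : ∀ i j i' j' : ℕ, i ≤ j → j < j' → 3 ^ i + 3 ^ j < 3 ^ i' + 3 ^ j' := by
    intro i j i' j' hij hj
    have h1 : 3 ^ i ≤ 3 ^ j := Nat.pow_le_pow_right (by norm_num) hij
    have h2 : 3 ^ (j + 1) ≤ 3 ^ j' := Nat.pow_le_pow_right (by norm_num) hj
    have h3 : 0 < 3 ^ j := by positivity
    have h4 : 0 < 3 ^ i' := by positivity
    rw [pow_succ] at h2
    omega
  rintro ⟨⟨i, j⟩, hij⟩ ⟨⟨i', j'⟩, hij'⟩ h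
  simp only at h hij hij'
  have hj : (j : ℕ) = j' := by
    rcases lt_trichotomy (j : ℕ) j' with hlt | heq | hgt
    · exact absurd h (aux _ _ i' _ hij hlt).ne
    · exact heq
    · exact absurd h (aux _ _ i _ hij' hgt).ne'
  have hi : (i : ℕ) = i' := by
    rw [hj] at h
    exact Nat.pow_right_injective (a := 3) (by norm_num) (Nat.add_right_cancel h)
  simp [Fin.ext_iff, hi, hj]

/-- The product `∏ₛ ((1 + X) ^ Nₛ - 1) ^ αₛ`. -/
noncomputable def onePlusXProd {ι : Type*} [Fintype ι] (N α : ι → ℕ) : Polynomial ℤ :=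
  ∏ s, ((1 + Polynomial.X) ^ N s - 1) ^ α s

lemma intCast_coeff_onePlusXProd {ι : Type*} [Fintype ι] (p : ℕ) [Fact p.Prime] (m α : ι → ℕ)
    (d : ℕ) :
    ((onePlusXProd (fun s => p ^ m s) α).coeff d : ZMod p) =
      if d = ∑ s, α s * p ^ m s then 1 else 0 := by
  have hmap : (onePlusXProd (fun s => p ^ m s) α).map (Int.castRingHom (ZMod p)) =
      Polynomial.X ^ ∑ s, α s * p ^ m s := by
    simp [onePlusXProd, Polynomial.map_prod, add_pow_char_pow, ← pow_mul, Finset.prod_pow_eq_pow_sum,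
      mul_comm]
  rw [← Polynomial.coeff_X_pow, ← hmap, Polynomial.coeff_map, eq_intCast]

section Difference

open Polynomial

variable (K : Type*) [Field K]

/-- The forward difference operator on polynomials. -/
noncomputable def fwdDiffEnd : Module.End K K[X] := taylor 1 - 1

/-- The polynomial `X (X - 1) ⋯ (X - d + 1) / d!`. -/
noncomputable def binomialPoly (d : ℕ) : K[X] := (d.factorial : K)⁻¹ • descPochhammer K d

variable {K}

lemma taylor_natCast_eq_pow (N : ℕ) :
    (taylor (N : K) : Module.End K K[X]) = (1 + fwdDiffEnd K) ^ N := by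
  induction N with
  | zero => simp [Module.End.one_eq_id]
  | succ N ih =>
    rw [pow_succ, ← ih]
    refine LinearMap.ext fun q => ?_
    simp [fwdDiffEnd, taylor_taylor]

variable [CharZero K]

lemma fwdDiffEnd_binomialPoly_succ (d : ℕ) :
    fwdDiffEnd K (binomialPoly K (d + 1)) = binomialPoly K d := by
  have h := congrArg (taylor (1 : K)) (descPochhammer_succ_comp_X_sub_one (R := K) d)
  have hcomp : ∀ q : K[X], taylor (1 : K) (q.comp (Polynomial.X - 1)) = q := by
    intro q
    rw [taylor_apply, comp_assoc]
    simp
  rw [map_sub, hcomp, smul_eq_mul, taylor_mul, hcomp] at h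
  have h' : taylor (1 : K) (descPochhammer K (d + 1)) - descPochhammer K (d + 1) =
      ((d : K) + 1) • descPochhammer K d := by
    rw [sub_eq_iff_eq_add', sub_eq_iff_eq_add.1 h.symm, Polynomial.smul_eq_C_mul]
    simp [taylor_apply]
  have hd : ((d : K) + 1) ≠ 0 := by exact_mod_cast d.succ_ne_zero
  rw [binomialPoly, map_smul, fwdDiffEnd, LinearMap.sub_apply, Module.End.one_apply, h', smul_smul,
    binomialPoly, Nat.factorial_succ]
  congr 1
  push_cast
  field_simp

lemma eval_zero_fwdDiffEnd_pow_binomialPoly (k d : ℕ) :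
    ((fwdDiffEnd K ^ k) (binomialPoly K d)).eval 0 = if k = d then 1 else 0 := by
  induction k generalizing d with
  | zero =>
    cases d <;> simp [binomialPoly]
  | succ k ih =>
    rw [pow_succ, Module.End.mul_apply]
    cases d with
    | zero => simp [binomialPoly, fwdDiffEnd]
    | succ d => simp [fwdDiffEnd_binomialPoly_succ, ih]

lemma eval_zero_aeval_fwdDiffEnd_binomialPoly (P : ℤ[X]) (d : ℕ) :
    (aeval (fwdDiffEnd K) P (binomialPoly K d)).eval 0 = (P.coeff d : K) := by
  induction P using Polynomial.induction_on' with
  | add P Q hP hQ => simp [hP, hQ]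
  | monomial k z =>
    simp [eval_zero_fwdDiffEnd_pow_binomialPoly, Polynomial.coeff_monomial]

lemma natDegree_binomialPoly (d : ℕ) : (binomialPoly K d).natDegree = d := by
  rw [binomialPoly, natDegree_smul _ (inv_ne_zero (by exact_mod_cast d.factorial_ne_zero)),
    descPochhammer_natDegree]

lemma taylor_eq_sum_derivative (q : K[X]) (r : K) (M : ℕ) (hM : q.natDegree ≤ M) :
    taylor r q = ∑ k ∈ Finset.range (M + 1),
      (r ^ k / (k.factorial : K)) • (derivative^[k] q) := by
  refine Polynomial.funext fun x => ?_
  rw [taylor_eval, add_comm, ← taylor_eval, eval_eq_sum_range' (n := M + 1)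
    (by rw [natDegree_taylor]; omega), eval_finsetSum]
  refine Finset.sum_congr rfl fun k _ => ?_
  have hk : (k.factorial : K) ≠ 0 := by exact_mod_cast k.factorial_ne_zero
  rw [taylor_coeff, ← factorial_smul_hasseDeriv]
  rw [LinearMap.smul_apply, eval_smul, eval_smul, nsmul_eq_mul, smul_eq_mul]
  field_simp

end Difference

section Intertwining

variable (p : ℕ) (K : Type*) [Field K] {n : ℕ} (c : Fin n → ℕ)

/-- The linear form `∑ cᵢ Xᵢ`. -/
noncomputable def linForm : MvPolynomial (Fin n) K := ∑ i, (c i : K) • X i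

/-- The linear map `K[u] → K[X₁, …, Xₙ]` with `u ^ k ↦ k! ℓ ^ (2k) / (p ^ k (2k)!)`, where
`ℓ = ∑ cᵢ Xᵢ`. It intertwines `cᵢ cⱼ d/du` with `p ∂ᵢ∂ⱼ`. -/
noncomputable def liftQuad : Polynomial K →ₗ[K] MvPolynomial (Fin n) K :=
  Polynomial.lsum fun k => LinearMap.toSpanSingleton K _
    (((k.factorial : K) / ((p : K) ^ k * ((2 * k).factorial : K))) • linForm K c ^ (2 * k))

lemma liftQuad_monomial (k : ℕ) (a : K) :
    liftQuad p K c (Polynomial.monomial k a) =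
      (a * ((k.factorial : K) / ((p : K) ^ k * ((2 * k).factorial : K)))) •
        linForm K c ^ (2 * k) := by
  simp [liftQuad, Polynomial.lsum_apply, Polynomial.sum_monomial_index, smul_smul]

lemma pderiv_linForm_pow (i : Fin n) (m : ℕ) :
    pderiv i (linForm K c ^ m) = ((m : K) * c i) • linForm K c ^ (m - 1) := by
  have h : pderiv i (linForm K c) = C (c i : K) := by
    simp [linForm, pderiv_X, Pi.single_apply, smul_eq_C_mul]
  rw [Derivation.leibniz_pow, h, smul_eq_C_mul, smul_eq_mul, nsmul_eq_mul, map_mul]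
  simp only [map_natCast]
  ring

lemma constantCoeff_liftQuad (q : Polynomial K) :
    constantCoeff (liftQuad p K c q) = q.eval 0 := by
  have h0 : constantCoeff (linForm K c) = 0 := by simp [linForm, constantCoeff_smul]
  induction q using Polynomial.induction_on' with
  | add q r hq hr => simp [hq, hr]
  | monomial k a =>
    rw [liftQuad_monomial, constantCoeff_smul, map_pow, h0]
    cases k <;> simp

variable [CharZero K]

lemma pderiv_pderiv_liftQuad (hp : p ≠ 0) (i j : Fin n) (q : Polynomial K) :
    (p : K) • pderiv i (pderiv j (liftQuad p K c q)) =
      ((c i : K) * c j) • liftQuad p K c (Polynomial.derivative q) := by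
  induction q using Polynomial.induction_on' with
  | add q r hq hr => simp only [map_add, smul_add, hq, hr]
  | monomial k a =>
    rw [Polynomial.derivative_monomial, liftQuad_monomial, liftQuad_monomial, Derivation.map_smul,
      pderiv_linForm_pow, Derivation.map_smul, Derivation.map_smul, pderiv_linForm_pow]
    cases k with
    | zero => simp
    | succ k =>
      have hk : ((2 * k).factorial : K) ≠ 0 := by exact_mod_cast (2 * k).factorial_ne_zero
      have hk₁ : ((k : K) * 2 + 1) ≠ 0 := by exact_mod_cast (k * 2).succ_ne_zero
      rw [show 2 * (k + 1) = 2 * k + 1 + 1 by ring, Nat.factorial_succ, Nat.factorial_succ,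
        Nat.factorial_succ]
      simp only [smul_smul, Nat.add_sub_cancel]
      congr 1
      push_cast
      have hk₃ : ((k : K) * 2 + 1 + 1) ≠ 0 := by exact_mod_cast (k * 2 + 1).succ_ne_zero
      have hp' : (p : K) ≠ 0 := by exact_mod_cast hp
      field_simp
      ring

lemma pderiv_pow_liftQuad (hp : p ≠ 0) (i j : Fin n) (q : Polynomial K) (k : ℕ) :
    (p : K) ^ k • ((((pderiv i).toLinearMap * (pderiv j).toLinearMap :
      Module.End K (MvPolynomial (Fin n) K)) ^ k) (liftQuad p K c q)) =
      ((c i : K) * c j) ^ k • liftQuad p K c (Polynomial.derivative^[k] q) := by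
  induction k with
  | zero => simp
  | succ k ih =>
    rw [pow_succ' _ k, pow_succ' _ k, Module.End.mul_apply, mul_smul, ← map_smul, ih, map_smul,
      smul_comm]
    change _ • (p : K) • pderiv i (pderiv j _) = _
    rw [pderiv_pderiv_liftQuad p K c hp, smul_smul, ← pow_succ, Function.iterate_succ_apply']

lemma natDegree_le_totalDegree_liftQuad (hp : p ≠ 0) (i : Fin n) (hc : c i ≠ 0)
    (q : Polynomial K) : q.natDegree ≤ (liftQuad p K c q).totalDegree := by
  rcases eq_or_ne q 0 with rfl | hq
  · simp
  let ψ : MvPolynomial (Fin n) K →ₐ[K] Polynomial K := aeval (Pi.single i Polynomial.X)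
  have hψ : ψ (linForm K c) = Polynomial.C (c i : K) * Polynomial.X := by
    simp [ψ, linForm, Pi.single_apply, Polynomial.smul_eq_C_mul]
  have hcoeff : ∀ (r : Polynomial K) (d : ℕ), (ψ (liftQuad p K c r)).coeff (2 * d) =
      r.coeff d * ((d.factorial : K) / ((p : K) ^ d * ((2 * d).factorial : K))) *
        (c i : K) ^ (2 * d) := by
    intro r d
    induction r using Polynomial.induction_on' with
    | add r t hr ht => simp only [map_add, Polynomial.coeff_add, hr, ht, add_mul]
    | monomial k a =>
      rw [liftQuad_monomial, map_smul, map_pow, hψ, mul_pow, ← map_pow, Polynomial.coeff_smul,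
        Polynomial.coeff_C_mul, Polynomial.coeff_X_pow, Polynomial.coeff_monomial]
      rcases eq_or_ne k d with rfl | hkd
      · simp
      · simp [hkd, hkd.symm]
  have hne : (ψ (liftQuad p K c q)).coeff (2 * q.natDegree) ≠ 0 := by
    rw [hcoeff]
    have hlead : q.coeff q.natDegree ≠ 0 := by simpa using hq
    have hfac : ∀ m : ℕ, (m.factorial : K) ≠ 0 := fun m => by exact_mod_cast m.factorial_ne_zero
    have hp' : (p : K) ≠ 0 := by exact_mod_cast hp
    have hc' : (c i : K) ≠ 0 := by exact_mod_cast hc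
    have h₁ := hfac q.natDegree
    have h₂ := hfac (2 * q.natDegree)
    positivity
  have hle : (ψ (liftQuad p K c q)).natDegree ≤ (liftQuad p K c q).totalDegree * 1 := by
    refine MvPolynomial.aeval_natDegree_le _ le_rfl _ fun t => ?_
    rcases eq_or_ne t i with rfl | hti
    · simp
    · simp [hti]
  have := Polynomial.le_natDegree_of_ne_zero hne
  omega

lemma Fop_liftQuad (hp : p ≠ 0) (hc : ∀ i, c i ≠ 0) (i j : Fin n) (q : Polynomial K) :
    Fop p K i j (liftQuad p K c q) =
      liftQuad p K c (Polynomial.aeval (fwdDiffEnd K)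
        ((1 + Polynomial.X) ^ (c i * c j) - 1 : Polynomial ℤ) q) := by
  have hT : Polynomial.aeval (fwdDiffEnd K) ((1 + Polynomial.X) ^ (c i * c j) - 1 : Polynomial ℤ) q
      = Polynomial.taylor ((c i : K) * c j) q - q := by
    rw [← Nat.cast_mul, taylor_natCast_eq_pow]
    simp
  rw [hT, taylor_eq_sum_derivative q _ _ (natDegree_le_totalDegree_liftQuad p K c hp i (hc i) q),
    Finset.range_eq_Ico, Finset.sum_eq_sum_Ico_succ_bot (Nat.succ_pos _)]
  simp only [pow_zero, Nat.factorial_zero, Nat.cast_one, div_one, one_smul, Function.iterate_zero,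
    id_eq, add_sub_cancel_left, map_sum, map_smul]
  refine Finset.sum_congr rfl fun k _ => ?_
  rw [div_eq_inv_mul, mul_smul, pderiv_pow_liftQuad p K c hp, smul_smul, ← div_eq_inv_mul]

lemma FopPow_liftQuad (hp : p ≠ 0) (hc : ∀ i, c i ≠ 0)
    (α : {q : Fin n × Fin n // q.1 ≤ q.2} → ℕ) (q : Polynomial K) :
    FopPow p K α (liftQuad p K c q) =
      liftQuad p K c (Polynomial.aeval (fwdDiffEnd K)
        (onePlusXProd (fun s => c s.1.1 * c s.1.2) α) q) := by
  have hone : ∀ f : MvPolynomial (Fin n) K,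
      (1 : Function.End (MvPolynomial (Fin n) K)) f = f := fun _ => rfl
  have hmul : ∀ (g g' : Function.End (MvPolynomial (Fin n) K)) (f : MvPolynomial (Fin n) K),
      (g * g') f = g (g' f) := fun _ _ _ => rfl
  have hpow : ∀ (i j : Fin n) (k : ℕ) (r : Polynomial K),
      (Fop p K i j ^ k) (liftQuad p K c r) = liftQuad p K c (Polynomial.aeval (fwdDiffEnd K)
        (((1 + Polynomial.X) ^ (c i * c j) - 1) ^ k : Polynomial ℤ) r) := by
    intro i j k r
    induction k with
    | zero => simp [hone]
    | succ k ih =>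
      rw [pow_succ', pow_succ', hmul, ih, Fop_liftQuad p K c hp hc, map_mul, Module.End.mul_apply]
  have hlist : ∀ l : List {q : Fin n × Fin n // q.1 ≤ q.2},
      (l.map fun s => Fop p K s.1.1 s.1.2 ^ α s).prod (liftQuad p K c q) =
        liftQuad p K c (Polynomial.aeval (fwdDiffEnd K)
          ((l.map fun s => ((1 + Polynomial.X) ^ (c s.1.1 * c s.1.2) - 1) ^ α s).prod :
            Polynomial ℤ) q) := by
    intro l
    induction l with
    | nil => simp [hone]
    | cons s l ih =>
      rw [List.map_cons, List.map_cons, List.prod_cons, List.prod_cons, hmul, ih, hpow, map_mul,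
        Module.End.mul_apply]
  rw [FopPow, hlist]
  congr 3
  rw [onePlusXProd, ← List.prod_toFinset]
  · congr 1
    ext ⟨⟨i, j⟩, hij⟩
    simp only [List.mem_toFinset, List.mem_flatMap, List.mem_finRange, true_and, Finset.mem_univ,
      iff_true]
    exact ⟨i, j, by simp [show i ≤ j from hij]⟩
  · have hfin := List.nodup_finRange n
    refine List.nodup_flatMap.2 ⟨fun i _ => List.nodup_flatMap.2 ⟨fun j _ => ?_, ?_⟩, ?_⟩
    · split_ifs <;> simp
    · refine hfin.imp fun {j j'} hne => ?_
      simp only [Function.onFun, List.disjoint_left]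
      intro s hs hs'
      split_ifs at hs hs' <;> simp_all
    · refine hfin.imp fun {i i'} hne => ?_
      simp only [Function.onFun, List.disjoint_left, List.mem_flatMap]
      rintro s ⟨j, -, hs⟩ ⟨j', -, hs'⟩
      split_ifs at hs hs' <;> simp_all

end Intertwining

lemma norm_intCast_le_one {p : ℕ} [Fact p.Prime] {K : Type*} [NormedField K]
    [NormedAlgebra ℚ_[p] K] (z : ℤ) : ‖(z : K)‖ ≤ 1 := by
  rw [← map_intCast (algebraMap ℚ_[p] K), norm_algebraMap']
  exact Padic.norm_int_le_one z

lemma norm_intCast_le_inv_of_dvd {p : ℕ} [Fact p.Prime] {K : Type*} [NormedField K]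
    [NormedAlgebra ℚ_[p] K] {z : ℤ} (hz : (p : ℤ) ∣ z) : ‖(z : K)‖ ≤ (p : ℝ)⁻¹ := by
  rw [← map_intCast (algebraMap ℚ_[p] K), norm_algebraMap']
  simpa using (Padic.norm_int_le_pow_iff_dvd z 1).2 (by simpa using hz)

/-- The metaplectic representation is injective on the Iwasawa algebra of the group `B`:
if `λ : ℕ^S → K` (`S = {(i,j) : i ≤ j}`) is a bounded family such that for every polynomial
`f` the (finite) sum `∑_α λ_α F^α f` vanishes (only the `α` with `2|α| ≤ deg f`
contribute, since `F^α f = 0` when `2|α| > deg f`), then `λ = 0`. -/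
theorem metaplectic_injective_on_KB (p : ℕ) [Fact p.Prime] (hp : Odd p)
    {K : Type*} [NontriviallyNormedField K] [NormedAlgebra ℚ_[p] K] [CompleteSpace K]
    [FiniteDimensional ℚ_[p] K]
    (hiso : ∀ x : ℚ_[p], ‖algebraMap ℚ_[p] K x‖ = ‖x‖)
    (hna : ∀ x y : K, ‖x + y‖ ≤ max ‖x‖ ‖y‖)
    {n : ℕ} (hn : 1 ≤ n)
    (lam : ({q : Fin n × Fin n // q.1 ≤ q.2} → ℕ) → K)
    (hbd : ∃ C : ℝ, ∀ α, ‖lam α‖ ≤ C)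
    (h : ∀ f : MvPolynomial (Fin n) K,
      ∑ α ∈ Finset.Iic (fun _ : {q : Fin n × Fin n // q.1 ≤ q.2} => f.totalDegree),
        lam α • FopPow p K α f = 0) :
    lam = 0 := by
  classical
  have hp0 : p ≠ 0 := (Fact.out : p.Prime).ne_zero
  have hp1 : 1 < p := (Fact.out : p.Prime).one_lt
  have : CharZero K := charZero_of_injective_algebraMap (algebraMap ℚ_[p] K).injective
  have : IsUltrametricDist K := IsUltrametricDist.isUltrametricDist_of_forall_norm_add_le_max_norm hna
  by_contra hne
  obtain ⟨α₀, hα₀⟩ := Function.ne_iff.1 hne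
  have hbdd : BddAbove (Set.range fun α => ‖lam α‖) := by
    obtain ⟨C, hC⟩ := hbd
    exact ⟨C, by rintro _ ⟨α, rfl⟩; exact hC α⟩
  set M : ℝ := ⨆ α, ‖lam α‖
  have hle : ∀ α, ‖lam α‖ ≤ M := le_ciSup hbdd
  have hM : 0 < M := (norm_pos_iff.2 hα₀).trans_le (hle α₀)
  have hp1' : (1 : ℝ) < p := by exact_mod_cast hp1
  have hlt : M * (p : ℝ)⁻¹ < M := mul_lt_of_lt_one_right hM (inv_lt_one_of_one_lt₀ hp1')
  obtain ⟨α, hα, hmin⟩ := exists_min_weight _ (three_pow_add_three_pow_injective n)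
    {α | M * (p : ℝ)⁻¹ < ‖lam α‖} (exists_lt_of_lt_ciSup hlt)
  set a := ∑ s, α s
  set m : {q : Fin n × Fin n // q.1 ≤ q.2} → ℕ :=
    fun s => a * (3 ^ (s.1.1 : ℕ) + 3 ^ (s.1.2 : ℕ)) with hm
  set c : Fin n → ℕ := fun i => p ^ (a * 3 ^ (i : ℕ)) with hc
  have hc0 : ∀ i, c i ≠ 0 := fun i => pow_ne_zero _ hp0
  have hcm : (fun s : {q : Fin n × Fin n // q.1 ≤ q.2} => c s.1.1 * c s.1.2) =
      fun s => p ^ m s := by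
    funext s
    simp only [hc, hm, ← pow_add, mul_add]
  set d := ∑ s, α s * p ^ m s with hd
  have hweight : ∀ β, β ≠ α → M * (p : ℝ)⁻¹ < ‖lam β‖ → d ≠ ∑ s, β s * p ^ m s := by
    intro β hβ hβM
    have := hmin (p ^ a) (Nat.lt_pow_self hp1) β hβM hβ
    simp only [← pow_mul] at this
    exact this.ne
  have hsum : ∑ β ∈ Finset.Iic (fun _ => (liftQuad p K c (binomialPoly K d)).totalDegree),
      lam β * ((onePlusXProd (fun s => p ^ m s) β).coeff d : K) = 0 := by
    have := congrArg constantCoeff (h (liftQuad p K c (binomialPoly K d)))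
    simpa only [map_sum, constantCoeff_smul, FopPow_liftQuad p K c hp0 hc0, constantCoeff_liftQuad,
      eval_zero_aeval_fwdDiffEnd_binomialPoly, hcm, smul_eq_mul, map_zero] using this
  have hmem : α ∈ Finset.Iic
      (fun _ => (liftQuad p K c (binomialPoly K d)).totalDegree) := by
    rw [Finset.mem_Iic]
    intro s
    calc α s ≤ α s * p ^ m s := Nat.le_mul_of_pos_right _ (by positivity)
      _ ≤ d := Finset.single_le_sum (f := fun s => α s * p ^ m s) (by simp) (Finset.mem_univ s)
      _ = (binomialPoly K d).natDegree := (natDegree_binomialPoly d).symm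
      _ ≤ _ := natDegree_le_totalDegree_liftQuad p K c hp0 ⟨0, hn⟩ (hc0 _) _
  have hterm : ∀ β, ‖lam β * (((onePlusXProd (fun s => p ^ m s) β).coeff d -
      if β = α then 1 else 0 : ℤ) : K)‖ ≤ M * (p : ℝ)⁻¹ := by
    intro β
    rw [norm_mul]
    by_cases hβ : β ≠ α ∧ ‖lam β‖ ≤ M * (p : ℝ)⁻¹
    · exact (mul_le_of_le_one_right (norm_nonneg _) (norm_intCast_le_one (p := p) _)).trans hβ.2
    · refine mul_le_mul (hle β) (norm_intCast_le_inv_of_dvd ?_) (norm_nonneg _) hM.le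
      rw [← ZMod.intCast_zmod_eq_zero_iff_dvd, Int.cast_sub, intCast_coeff_onePlusXProd]
      rcases eq_or_ne β α with rfl | hne'
      · simp [hd]
      · have hβM : M * (p : ℝ)⁻¹ < ‖lam β‖ := by
          by_contra hcon
          exact hβ ⟨hne', not_lt.1 hcon⟩
        simp [hne', hweight β hne' hβM]
  have hα_eq : ∑ β ∈ Finset.Iic (fun _ => (liftQuad p K c (binomialPoly K d)).totalDegree),
      lam β * (((onePlusXProd (fun s => p ^ m s) β).coeff d - if β = α then 1 else 0 : ℤ) : K) =
      -lam α := by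
    simp only [Int.cast_sub, mul_sub, Finset.sum_sub_distrib, hsum]
    simpa using fun hnot => absurd (Finset.mem_Iic.1 hmem) hnot
  have hcontra := IsUltrametricDist.norm_sum_le_of_forall_le_of_nonneg
    (s := Finset.Iic (fun _ => (liftQuad p K c (binomialPoly K d)).totalDegree))
    (by positivity : 0 ≤ M * (p : ℝ)⁻¹) fun β _ => hterm β
  rw [hα_eq, norm_neg] at hcontra
  exact absurd hα (not_lt.2 hcontra)
end
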